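/- For f : Sⁿ → Sⁿ a map of positive degree, TC(f) = TC(Sⁿ), which equals 1 if n is odd and 2 if n is even. -/

import Mathlib

open ContinuousMap Set

/-- `U ⊆ B` is `f`-categorical for `p : E → B`: it is open and admits `s : U → E`
with `f ∘ p ∘ s` homotopic to `f|_U`. -/
def IsFCatOpen {E B X : Type} [TopologicalSpace E] [TopologicalSpace B] [TopologicalSpace X]
    (p : C(E, B)) (f : C(B, X)) (U : Set B) : Prop :=
  IsOpen U ∧ ∃ s : C(U, E), ((f.comp p).comp s).Homotopic (f.restrict U)

/-- The `f`-sectional category `secat_f(p)`: least `n` such that `B` is covered by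
`n+1` `f`-categorical open sets (`⊤` if none exists). -/
noncomputable def secatF {E B X : Type} [TopologicalSpace E] [TopologicalSpace B] [TopologicalSpace X]
    (p : C(E, B)) (f : C(B, X)) : ℕ∞ :=
  sInf ((↑) '' {n : ℕ | ∃ U : Fin (n + 1) → Set B,
    (∀ i, IsFCatOpen p f (U i)) ∧ ⋃ i, U i = univ})

/-- The (normalized) Lusternik–Schnirelmann category of a map: least `n` such that the
domain is covered by `n+1` open sets on each of which the map is null-homotopic. -/
noncomputable def catMap {B X : Type} [TopologicalSpace B] [TopologicalSpace X]
    (f : C(B, X)) : ℕ∞ :=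
  sInf ((↑) '' {n : ℕ | ∃ U : Fin (n + 1) → Set B,
    (∀ i, IsOpen (U i) ∧ (f.restrict (U i)).Nullhomotopic) ∧ ⋃ i, U i = univ})

/-- The path fibration `π : X^I → X × X`, `π(α) = (α 0, α 1)`. -/
noncomputable def pathFib (X : Type) [TopologicalSpace X] : C(C(unitInterval, X), X × X) :=
  ⟨fun α => (α 0, α 1), by fun_prop⟩

/-- The diagonal map `Δ : X → X × X`. -/
def diagMap (X : Type) [TopologicalSpace X] : C(X, X × X) := ⟨fun x => (x, x), by fun_prop⟩

/-- The topological complexity of a map, `TC(f) = secat_{f×f}(π)`. -/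
noncomputable def TCmap {X Y : Type} [TopologicalSpace X] [TopologicalSpace Y] (f : C(X, Y)) : ℕ∞ :=
  secatF (pathFib X) (f.prodMap f)

namespace TCS
section cochains
variable {V : Type*}

def skip (i j : ℕ) : ℕ := if j < i then j else j + 1

def dl (k : ℕ) (φ : (ℕ → V) → ℤ) : (ℕ → V) → ℤ :=
  fun x => ∑ i ∈ Finset.range (k + 2), (-1) ^ i * φ (x ∘ skip i)

def Dep (k : ℕ) (φ : (ℕ → V) → ℤ) : Prop :=
  ∀ x y : ℕ → V, (∀ j ≤ k, x j = y j) → φ x = φ y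

def sh (p : ℕ) (x : ℕ → V) : ℕ → V := fun j => x (p + j)

def cup (p : ℕ) (φ ψ : (ℕ → V) → ℤ) : (ℕ → V) → ℤ := fun x => φ x * ψ (sh p x)

def ev (w : V → ℤ) : (ℕ → V) → ℤ := fun x => w (x 0)

theorem leibniz (p q : ℕ) (φ ψ : (ℕ → V) → ℤ) (hφ : Dep p φ) (x : ℕ → V) :
    dl (p + q) (cup p φ ψ) x = cup (p + 1) (dl p φ) ψ x + (-1) ^ p * cup p φ (dl q ψ) x := by
  have h1 : ∀ i, p < i → φ (x ∘ skip i) = φ x := by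
    intro i hi
    apply hφ
    intro j hj
    simp [skip, show j < i by omega]
  have h2 : ∀ i, i ≤ p → sh p (x ∘ skip i) = sh (p + 1) x := by
    intro i hi
    funext j
    simp only [sh, Function.comp, skip]
    rw [if_neg (by omega)]
    congr 1; omega
  have h3 : ∀ i, sh p (x ∘ skip (p + 1 + i)) = sh p x ∘ skip (i + 1) := by
    intro i
    funext j
    simp only [sh, Function.comp, skip]
    by_cases h : j < i + 1
    · rw [if_pos (by omega), if_pos h]
    · rw [if_neg (by omega), if_neg h]; rfl
  have h4 : sh p x ∘ skip 0 = sh (p + 1) x := by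
    funext j
    simp only [sh, Function.comp, skip]
    simp
    congr 1; omega
  simp only [dl, cup]
  rw [show p + q + 2 = (p + 1) + (q + 1) by ring, Finset.sum_range_add]
  rw [show p + 2 = p + 1 + 1 by ring, show q + 2 = q + 1 + 1 by ring, Finset.sum_range_succ _ (p + 1), Finset.sum_range_succ' _ (q + 1)]
  rw [h1 (p + 1) (by omega)]
  have e1 : ∑ i ∈ Finset.range (p + 1), (-1) ^ i * (φ (x ∘ skip i) * ψ (sh p (x ∘ skip i)))
     = (∑ i ∈ Finset.range (p + 1), (-1) ^ i * φ (x ∘ skip i)) * ψ (sh (p + 1) x) := by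
    rw [Finset.sum_mul]
    apply Finset.sum_congr rfl
    intro i hi
    rw [h2 i (by simp at hi; omega)]; ring
  have e2 : ∑ i ∈ Finset.range (q + 1), (-1) ^ (p + 1 + i) *
      (φ (x ∘ skip (p + 1 + i)) * ψ (sh p (x ∘ skip (p + 1 + i))))
     = (-1) ^ p * (φ x * ∑ i ∈ Finset.range (q + 1), (-1) ^ (i + 1) * ψ (sh p x ∘ skip (i + 1))) := by
    rw [Finset.mul_sum, Finset.mul_sum]
    apply Finset.sum_congr rfl
    intro i hi
    rw [h1 _ (by omega), h3]; ring
  rw [e1, e2, h4]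
  ring

theorem skip_comm (i j l : ℕ) (h : i ≤ j) : skip (j + 1) (skip i l) = skip i (skip j l) := by
  unfold skip; split_ifs <;> omega

theorem dl_dl (k : ℕ) (φ : (ℕ → V) → ℤ) (x : ℕ → V) : dl (k + 1) (dl k φ) x = 0 := by
  unfold dl
  simp only [Finset.mul_sum]
  rw [← Finset.sum_product']
  apply Finset.sum_involution
    (g := fun p _ => if p.1 ≤ p.2 then (p.2 + 1, p.1) else (p.2, p.1 - 1))
  · rintro ⟨i, j⟩ h
    simp only
    have key : ∀ i j, i ≤ j → (x ∘ skip (j + 1)) ∘ skip i = (x ∘ skip i) ∘ skip j := by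
      intro i j h; funext l; simp [skip_comm i j l h]
    split_ifs with hij
    · simp only
      rw [key i j hij]; ring
    · simp only
      obtain ⟨i, rfl⟩ : ∃ i', i = i' + 1 := ⟨i - 1, by omega⟩
      rw [Nat.add_sub_cancel, key j i (by omega)]; ring
  · rintro ⟨i, j⟩ h h'
    simp only
    split_ifs with hij
    · intro h; simp at h; omega
    · intro h; simp at h; omega
  · rintro ⟨i, j⟩ h
    by_cases hij : i ≤ j
    · simp [hij]
    · have : j ≤ i - 1 := by omega
      simp only [hij, this, if_true, if_false]; ext <;> simp; omega
  · rintro ⟨i, j⟩ h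
    simp only [Finset.mem_product, Finset.mem_range] at h ⊢
    split_ifs with hij <;> simp only <;> omega

def bb (n : ℕ) (u : ℕ → V → ℤ) : (ℕ → V) → ℤ :=
  fun x => ∏ i ∈ Finset.range n, (u i (x (i + 1)) - u i (x i))

def aa (n : ℕ) (u : ℕ → V → ℤ) : (ℕ → V) → ℤ := fun x => bb n u x * u n (x n)

theorem dep_bb (n : ℕ) (u : ℕ → V → ℤ) : Dep n (bb n u) := by
  intro x y h
  unfold bb
  apply Finset.prod_congr rfl
  intro i hi
  simp at hi
  rw [h i (by omega), h (i + 1) (by omega)]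

theorem dep_aa (n : ℕ) (u : ℕ → V → ℤ) : Dep n (aa n u) := by
  intro x y h
  unfold aa
  rw [dep_bb n u x y h, h n le_rfl]

theorem dep_cup (p q : ℕ) (φ ψ : (ℕ → V) → ℤ) (h1 : Dep p φ) (h2 : Dep q ψ) :
    Dep (p + q) (cup p φ ψ) := by
  intro x y h
  unfold cup
  rw [h1 x y (fun j hj => h j (by omega)), h2 (sh p x) (sh p y) (fun j hj => h _ (by omega))]

theorem dep_ev (w : V → ℤ) : Dep 0 (ev w) := by
  intro x y h; simp [ev, h 0 le_rfl]

theorem dl_ev (w : V → ℤ) (x : ℕ → V) : dl 0 (ev w) x = w (x 1) - w (x 0) := by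
  simp [dl, ev, Finset.sum_range_succ, skip]; ring

theorem dl_bb (n : ℕ) (u : ℕ → V → ℤ) (x : ℕ → V) : dl n (bb n u) x = 0 := by
  induction n generalizing x with
  | zero => simp [dl, bb, Finset.sum_range_succ]
  | succ n ih =>
    have h : bb (n + 1) u = cup n (bb n u) (dl 0 (ev (u n))) := by
      funext y
      simp [bb, cup, Finset.prod_range_succ, dl_ev, sh]
    rw [h, leibniz n 1 _ _ (dep_bb n u)]
    have : dl n (bb n u) = fun _ => 0 := by funext y; exact ih y
    simp only [cup, this, dl_dl 0]
    simp

theorem dl_aa (n : ℕ) (u : ℕ → V → ℤ) (x : ℕ → V) :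
    dl n (aa n u) x = (-1) ^ n * bb (n + 1) u x := by
  have h : aa n u = cup n (bb n u) (ev (u n)) := by
    funext y; simp [aa, cup, ev, sh]
  have := leibniz n 0 (bb n u) (ev (u n)) (dep_bb n u) x
  rw [h]
  simp only [add_zero] at this
  rw [this]
  simp only [cup, dl_bb, dl_ev]
  simp [bb, Finset.prod_range_succ, sh]

theorem dl_add (k : ℕ) (φ ψ : (ℕ → V) → ℤ) (x : ℕ → V) :
    dl k (fun y => φ y + ψ y) x = dl k φ x + dl k ψ x := by
  simp [dl, mul_add, Finset.sum_add_distrib]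

theorem dl_smul (k : ℕ) (c : ℤ) (φ : (ℕ → V) → ℤ) (x : ℕ → V) :
    dl k (fun y => c * φ y) x = c * dl k φ x := by
  simp only [dl, Finset.mul_sum]
  apply Finset.sum_congr rfl
  intros; ring

theorem dl_sub (k : ℕ) (φ ψ : (ℕ → V) → ℤ) (x : ℕ → V) :
    dl k (fun y => φ y - ψ y) x = dl k φ x - dl k ψ x := by
  simp [dl, mul_sub, Finset.sum_sub_distrib]

/-- change of one coordinate function -/
theorem contig_one (q r : ℕ) (hr : r ≤ q + 1) (u u' : ℕ → V → ℤ) (huu : ∀ i, i ≠ r → u i = u' i)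
    (P : (ℕ → V) → Prop)
    (hP : ∀ x, P x → ∃ s ≤ q + 1, ∃ c, ∀ i, u s (x i) = c ∧ u' s (x i) = c) :
    ∃ β : (ℕ → V) → ℤ, Dep q β ∧ ∀ x, P x → aa (q + 1) u x - aa (q + 1) u' x = dl q β x := by
  rcases Nat.lt_or_ge q r with h | h
  · obtain rfl : r = q + 1 := by omega
    refine ⟨fun _ => 0, fun _ _ _ => rfl, fun x hx => ?_⟩
    have e : bb (q + 1) u' x = bb (q + 1) u x := by
      unfold bb
      apply Finset.prod_congr rfl
      intro i hi
      simp at hi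
      rw [huu i (by omega)]
    have z : dl q (fun _ : ℕ → V => (0 : ℤ)) x = 0 := by simp [dl]
    rw [z]; unfold aa
    rw [e, ← mul_sub]
    obtain ⟨s, hs, c, hc⟩ := hP x hx
    rcases Nat.lt_or_ge s (q + 1) with h' | h'
    · have : bb (q + 1) u x = 0 := by
        unfold bb
        apply Finset.prod_eq_zero (Finset.mem_range.2 h')
        rw [(hc _).1, (hc _).1]; ring
      rw [this]; ring
    · obtain rfl : s = q + 1 := by omega
      rw [(hc _).1, (hc _).2]; ring
  · obtain ⟨t, rfl⟩ := Nat.exists_eq_add_of_le h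
    set k : V → ℤ := fun v => u r v - u' r v with hk
    set χ := aa t (fun i => u (r + 1 + i)) with hχ
    refine ⟨fun y => (-1) ^ r * cup r (bb r u) (cup 0 (ev k) χ) y, ?_, ?_⟩
    · have := dep_cup r (0 + t) _ _ (dep_bb r u) (dep_cup 0 t _ χ (dep_ev k) (dep_aa t _))
      intro x y hxy
      simp only
      rw [this x y (by simpa using hxy)]
    · intro x hx
      rw [dl_smul, leibniz r t _ _ (dep_bb r u)]
      have l2 := leibniz 0 t (ev k) χ (dep_ev k) (sh r x)
      rw [zero_add] at l2
      simp only [cup] at l2 ⊢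
      rw [l2, dl_bb, dl_ev, hχ, dl_aa]
      -- expand the two sides
      have e0 : ∀ w : ℕ → V → ℤ, (∀ i, i ≠ r → w i = u i) → aa (r + t + 1) w x =
          bb r u x * ((w r (x (r + 1)) - w r (x r)) * aa t (fun i => u (r + 1 + i)) (sh (r + 1) x)) := by
        intro w hw
        unfold aa bb
        rw [show r + t + 1 = r + 1 + t by ring, Finset.prod_range_add, Finset.prod_range_succ]
        have : ∏ i ∈ Finset.range r, (w i (x (i + 1)) - w i (x i)) =
            ∏ i ∈ Finset.range r, (u i (x (i + 1)) - u i (x i)) := by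
          apply Finset.prod_congr rfl
          intro i hi; simp at hi; rw [hw i (by omega)]
        rw [this]
        have : ∏ i ∈ Finset.range t, (w (r + 1 + i) (x (r + 1 + i + 1)) - w (r + 1 + i) (x (r + 1 + i))) =
            ∏ i ∈ Finset.range t, (u (r + 1 + i) (sh (r + 1) x (i + 1)) - u (r + 1 + i) (sh (r + 1) x i)) := by
          apply Finset.prod_congr rfl
          intro i hi; rw [hw _ (by omega)]; rfl
        rw [this, hw (r + 1 + t) (by omega)]
        simp only [sh]; ring
      rw [e0 u (fun _ _ => rfl), e0 u' (fun i hi => (huu i hi).symm)]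
      have e1 : sh (0 + 1) (sh r x) = sh (r + 1) x := by
        funext j; simp only [sh]; congr 1; ring
      have e2 : sh 0 (sh r x) = sh r x := by funext j; simp [sh]
      rw [e1, e2]
      have van : bb r u x * (k (x r) * bb (t + 1) (fun i => u (r + 1 + i)) (sh r x)) = 0 := by
        obtain ⟨s, hs, c, hc⟩ := hP x hx
        rcases lt_trichotomy s r with h' | h' | h'
        · have : bb r u x = 0 := by
            unfold bb
            apply Finset.prod_eq_zero (Finset.mem_range.2 h')
            rw [(hc _).1, (hc _).1]; ring
          rw [this]; ring
        · subst h'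
          have : k (x s) = 0 := by simp only [hk]; rw [(hc _).1, (hc _).2]; ring
          rw [this]; ring
        · have : bb (t + 1) (fun i => u (r + 1 + i)) (sh r x) = 0 := by
            unfold bb
            apply Finset.prod_eq_zero (i := s - (r + 1)) (Finset.mem_range.2 (by omega))
            simp only [sh]
            rw [show r + 1 + (s - (r + 1)) = s by omega, (hc _).1, (hc _).1]; ring
          rw [this]; ring
      have e3 : ev k (sh r x) = k (x r) := by simp [ev, sh]
      have e4 : k (sh r x 1) - k (sh r x 0) =
          (u r (x (r + 1)) - u r (x r)) - (u' r (x (r + 1)) - u' r (x r)) := by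
        simp [sh, hk]; ring
      rw [e3, e4]
      have s2 : ((-1 : ℤ) ^ r) * (-1) ^ r = 1 := by rw [← mul_pow]; simp
      linear_combination (-(bb r u x * ((u r (x (r + 1)) - u r (x r)) - (u' r (x (r + 1)) - u' r (x r))) * aa t (fun i => u (r + 1 + i)) (sh (r + 1) x))) * s2 - ((-1) ^ r * (-1) ^ r * (-1) ^ t) * van

theorem contig (q : ℕ) (u u' : ℕ → V → ℤ) (P : (ℕ → V) → Prop)
    (hP : ∀ x, P x → ∃ s ≤ q + 1, ∃ c, ∀ i, u s (x i) = c ∧ u' s (x i) = c) :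
    ∃ β : (ℕ → V) → ℤ, Dep q β ∧ ∀ x, P x → aa (q + 1) u x - aa (q + 1) u' x = dl q β x := by
  have main : ∀ r ≤ q + 2, ∃ β : (ℕ → V) → ℤ, Dep q β ∧ ∀ x, P x →
      aa (q + 1) u x - aa (q + 1) (fun i => if i < r then u' i else u i) x = dl q β x := by
    intro r
    induction r with
    | zero => intro _; exact ⟨fun _ => 0, fun _ _ _ => rfl, fun x _ => by simp [dl]⟩
    | succ r ih =>
      intro hr
      obtain ⟨β, hβ, h⟩ := ih (by omega)
      obtain ⟨β', hβ', h'⟩ := contig_one q r (by omega) (fun i => if i < r then u' i else u i)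
        (fun i => if i < r + 1 then u' i else u i) (by
          intro i hi
          by_cases h1 : i < r
          · simp [h1, show i < r + 1 by omega]
          · simp [h1, show ¬ i < r + 1 by omega]) P (by
          intro x hx
          obtain ⟨s, hs, c, hc⟩ := hP x hx
          refine ⟨s, hs, c, fun i => ⟨?_, ?_⟩⟩ <;> split_ifs <;>
            simp [(hc i).1, (hc i).2])
      refine ⟨fun y => β y + β' y, fun x y hxy => by simp only; rw [hβ x y hxy, hβ' x y hxy], ?_⟩
      intro x hx
      rw [dl_add, ← h x hx, ← h' x hx]; ring
  obtain ⟨β, hβ, h⟩ := main (q + 2) le_rfl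
  refine ⟨β, hβ, fun x hx => ?_⟩
  rw [← h x hx]
  congr 1
  unfold aa bb
  congr 1
  · apply Finset.prod_congr rfl
    intro i hi
    simp at hi
    simp [show i < q + 2 by omega]
  · simp

end cochains
end TCS

namespace TCS
section torus
variable {m N : ℕ}

def pth (g : Fin m → ZMod N) (σ : Equiv.Perm (Fin m)) : ℕ → (Fin m → ZMod N) :=
  fun k c => g c + if (σ.symm c).val < k then 1 else 0

def EE [NeZero N] (φ : (ℕ → (Fin m → ZMod N)) → ℤ) : ℤ :=
  ∑ g : Fin m → ZMod N, ∑ σ : Equiv.Perm (Fin m), (Equiv.Perm.sign σ : ℤ) * φ (pth g σ)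

theorem EE_add [NeZero N] (φ ψ : (ℕ → (Fin m → ZMod N)) → ℤ) :
    EE (fun x => φ x + ψ x) = EE φ + EE ψ := by
  simp [EE, mul_add, Finset.sum_add_distrib]

theorem EE_sub [NeZero N] (φ ψ : (ℕ → (Fin m → ZMod N)) → ℤ) :
    EE (fun x => φ x - ψ x) = EE φ - EE ψ := by
  simp [EE, mul_sub, Finset.sum_sub_distrib]

theorem EE_smul [NeZero N] (c : ℤ) (φ : (ℕ → (Fin m → ZMod N)) → ℤ) :
    EE (fun x => c * φ x) = c * EE φ := by
  simp only [EE, Finset.mul_sum]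
  refine Finset.sum_congr rfl fun _ _ => Finset.sum_congr rfl fun _ _ => by ring

theorem EE_congr [NeZero N] (φ ψ : (ℕ → (Fin m → ZMod N)) → ℤ)
    (h : ∀ g σ, φ (pth g σ) = ψ (pth g σ)) : EE φ = EE ψ := by
  simp [EE, h]

theorem EE_zero [NeZero N] (φ : (ℕ → (Fin m → ZMod N)) → ℤ)
    (h : ∀ g σ, φ (pth g σ) = 0) : EE φ = 0 := by
  simp [EE, h]

theorem EE_sum [NeZero N] {ι : Type*} (s : Finset ι) (φ : ι → (ℕ → (Fin m → ZMod N)) → ℤ) :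
    EE (fun x => ∑ i ∈ s, φ i x) = ∑ i ∈ s, EE (φ i) := by
  classical
  induction s using Finset.induction_on with
  | empty => simp [EE]
  | insert a s ha ih => simp only [Finset.sum_insert ha]; rw [EE_add, ih]

theorem stokes (p N : ℕ) [NeZero N] (φ : (ℕ → (Fin (p + 1) → ZMod N)) → ℤ) (hφ : Dep p φ) :
    EE (dl p φ) = 0 := by
  unfold dl
  rw [EE_sum]
  simp only [EE_smul]
  -- interior faces
  have hint : ∀ i < p, EE (fun x : ℕ → (Fin (p + 1) → ZMod N) => φ (x ∘ skip (i + 1))) = 0 := by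
    intro i hi
    unfold EE
    apply Finset.sum_eq_zero
    intro g _
    set s : Equiv.Perm (Fin (p + 1)) := Equiv.swap ⟨i, by omega⟩ ⟨i + 1, by omega⟩ with hs
    have hsne : (⟨i, by omega⟩ : Fin (p + 1)) ≠ ⟨i + 1, by omega⟩ := by simp
    have key : ∀ σ : Equiv.Perm (Fin (p + 1)), pth g (σ * s) ∘ skip (i + 1) = pth g σ ∘ skip (i + 1) := by
      intro σ
      funext j c
      simp only [Function.comp, pth]
      congr 1
      have : (σ * s).symm c = s (σ.symm c) := by
        rw [Equiv.symm_apply_eq]; simp [hs]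
      rw [this]
      set v := σ.symm c
      have hL : skip (i + 1) j ≠ i + 1 := by unfold skip; split_ifs <;> omega
      have : ((s v).val < skip (i + 1) j) ↔ (v.val < skip (i + 1) j) := by
        by_cases h1 : v = ⟨i, by omega⟩
        · rw [h1, hs, Equiv.swap_apply_left]; simp; omega
        · by_cases h2 : v = ⟨i + 1, by omega⟩
          · rw [h2, hs, Equiv.swap_apply_right]; simp; omega
          · rw [hs, Equiv.swap_apply_of_ne_of_ne h1 h2]
      simp [this]
    have h := Fintype.sum_equiv (Equiv.mulRight s)
      (fun σ => ((Equiv.Perm.sign (σ * s) : ℤˣ) : ℤ) * φ (pth g (σ * s) ∘ skip (i + 1)))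
      (fun σ => ((Equiv.Perm.sign σ : ℤˣ) : ℤ) * φ (pth g σ ∘ skip (i + 1))) (fun σ => rfl)
    simp only [key] at h
    have hsg : Equiv.Perm.sign s = -1 := Equiv.Perm.sign_swap hsne
    simp only [Equiv.Perm.sign_mul, hsg] at h
    simp only [mul_neg, mul_one, Units.val_neg, neg_mul, Finset.sum_neg_distrib] at h
    linarith
  have hends : EE (fun x : ℕ → (Fin (p + 1) → ZMod N) => φ (x ∘ skip 0)) = 
      (-1) ^ p * EE (fun x : ℕ → (Fin (p + 1) → ZMod N) => φ (x ∘ skip (p + 1))) := by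
    unfold EE
    conv_lhs => rw [Finset.sum_comm]
    conv_rhs => rw [Finset.sum_comm]
    rw [Finset.mul_sum]
    refine Fintype.sum_equiv (Equiv.mulRight (finRotate (p + 1))) _ _ fun σ => ?_
    rw [Finset.mul_sum]
    refine Fintype.sum_equiv (Equiv.addRight (Pi.single (σ 0) 1)) _ _ fun g => ?_
    simp only [Equiv.coe_mulRight, Equiv.coe_addRight, Equiv.Perm.sign_mul, sign_finRotate]
    have : φ (pth g σ ∘ skip 0) = φ (pth (g + Pi.single (σ 0) 1) (σ * finRotate (p + 1)) ∘ skip (p + 1)) := by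
      apply hφ
      intro j hj
      funext c
      simp only [Function.comp, pth]
      have e1 : skip 0 j = j + 1 := by simp [skip]
      have e2 : skip (p + 1) j = j := by simp [skip]; omega
      rw [e1, e2]
      obtain ⟨v, rfl⟩ : ∃ v, c = σ v := ⟨σ.symm c, by simp⟩
      have e3 : (σ * finRotate (p + 1)).symm (σ v) = (finRotate (p + 1)).symm v := by
        rw [Equiv.symm_apply_eq]; simp
      rw [e3]
      simp only [Equiv.symm_apply_apply, Pi.add_apply]
      by_cases hv : v = 0
      · subst hv
        have : (finRotate (p + 1)).symm 0 = Fin.last p := by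
          rw [Equiv.symm_apply_eq]; simp
        rw [this]
        simp; omega
      · have h0 : σ v ≠ σ 0 := fun h => hv (σ.injective h)
        rw [Pi.single_eq_of_ne h0]
        obtain ⟨w, rfl⟩ := Fin.exists_succ_eq.2 hv
        have : (finRotate (p + 1)).symm w.succ = w.castSucc := by
          rw [Equiv.symm_apply_eq]
          rw [finRotate_apply]
          simp
        rw [this]
        simp
    rw [this]
    have s2 : ((-1 : ℤ) ^ p) * (-1) ^ p = 1 := by rw [← mul_pow]; simp
    simp only [Nat.add_sub_cancel, Units.val_mul, Units.val_pow_eq_pow_val, Units.val_neg, Units.val_one]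
    linear_combination (-(Equiv.Perm.sign σ : ℤ) * φ (pth (g + Pi.single (σ 0) 1) (σ * finRotate (p + 1)) ∘ skip (p + 1))) * s2
  rw [Finset.sum_range_succ, Finset.sum_range_succ']
  rw [hends, Finset.sum_eq_zero (fun i hi => by rw [hint i (by simpa using hi)]; ring)]
  ring

theorem main_cup (q N : ℕ) [NeZero N] (ω β₁ β₂ : (ℕ → (Fin ((q + 1) + (q + 1)) → ZMod N)) → ℤ)
    (hω : Dep (q + 1) ω) (hβ₁ : Dep q β₁) (hβ₂ : Dep q β₂)
    (hc : ∀ g σ p, dl (q + 1) ω (sh p (pth g σ)) = 0)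
    (h : ∀ g σ, ω (pth g σ) = dl q β₁ (pth g σ) ∨
      ω (sh (q + 1) (pth g σ)) = dl q β₂ (sh (q + 1) (pth g σ))) :
    EE (cup (q + 1) ω ω) = 0 := by
  have hst : ∀ φ : (ℕ → (Fin ((q + 1) + (q + 1)) → ZMod N)) → ℤ, Dep (q + 1 + q) φ →
    EE (dl (q + 1 + q) φ) = 0 := fun φ hφ => stokes (q + 1 + q) N φ hφ
  have hsh0 : ∀ x : ℕ → (Fin ((q + 1) + (q + 1)) → ZMod N), sh 0 x = x := by
    intro x; funext j; simp [sh]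
  have ddep : Dep (q + 1) (dl q β₂) := by
    intro x y hxy
    unfold dl
    refine Finset.sum_congr rfl fun i hi => ?_
    rw [hβ₂ (x ∘ skip i) (y ∘ skip i)]
    intro j hj
    apply hxy
    unfold skip; split_ifs <;> omega
  have A1 : EE (cup (q + 1) (dl q β₁) ω) = 0 := by
    have e : EE (fun x => dl (q + (q + 1)) (cup q β₁ ω) x) = 0 := by
      rw [show q + (q + 1) = q + 1 + q by ring]
      exact hst _ (by rw [show q + 1 + q = q + (q + 1) by ring]; exact dep_cup q (q + 1) _ _ hβ₁ hω)
    rw [← e]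
    apply EE_congr
    intro g σ
    rw [leibniz q (q + 1) _ _ hβ₁]
    simp [cup, hc]
  have A2 : EE (cup (q + 1) (dl q β₁) (dl q β₂)) = 0 := by
    have e : EE (fun x => dl (q + (q + 1)) (cup q β₁ (dl q β₂)) x) = 0 := by
      rw [show q + (q + 1) = q + 1 + q by ring]
      exact hst _ (by rw [show q + 1 + q = q + (q + 1) by ring]; exact dep_cup q (q + 1) _ _ hβ₁ ddep)
    rw [← e]
    apply EE_congr
    intro g σ
    rw [leibniz q (q + 1) _ _ hβ₁]
    simp [cup, dl_dl]
  have A3 : EE (cup (q + 1) ω (dl q β₂)) = 0 := by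
    have e := hst _ (dep_cup (q + 1) q _ _ hω hβ₂)
    have e' : EE (dl (q + 1 + q) (cup (q + 1) ω β₂)) =
        EE (fun x => (-1) ^ (q + 1) * cup (q + 1) ω (dl q β₂) x) := by
      apply EE_congr
      intro g σ
      rw [leibniz (q + 1) q _ _ hω]
      have := hc g σ 0
      rw [hsh0] at this
      simp [cup, this]
    rw [e', EE_smul] at e
    rcases mul_eq_zero.1 e with h | h
    · simp at h
    · exact h
  have A0 : EE (fun x => cup (q + 1) ω ω x - cup (q + 1) (dl q β₁) ω x
      - cup (q + 1) ω (dl q β₂) x + cup (q + 1) (dl q β₁) (dl q β₂) x) = 0 := by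
    apply EE_zero
    intro g σ
    simp only [cup]
    rcases h g σ with h | h <;> rw [h] <;> ring
  rw [EE_add, EE_sub, EE_sub] at A0
  rw [show (EE fun x => cup (q + 1) (dl q β₁) (dl q β₂) x) = 0 from A2,
    show (EE fun x => cup (q + 1) (dl q β₁) ω x) = 0 from A1,
    show (EE fun x => cup (q + 1) ω (dl q β₂) x) = 0 from A3] at A0
  simpa using A0

end torus
end TCS

namespace TCS
section prodeval
variable {n N : ℕ}

def lft (z : Fin (n + n) → ZMod N) : Fin n → ZMod N := fun i => z (Fin.castAdd n i)
def rgt (z : Fin (n + n) → ZMod N) : Fin n → ZMod N := fun i => z (Fin.natAdd n i)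

theorem pth_step {m : ℕ} (g : Fin m → ZMod N) (σ : Equiv.Perm (Fin m)) (k : ℕ) (c : Fin m)
    (h : (σ.symm c).val ≠ k) : pth g σ (k + 1) c = pth g σ k c := by
  unfold pth
  congr 1
  have : ((σ.symm c).val < k + 1) ↔ ((σ.symm c).val < k) := by omega
  simp [this]

theorem EE_reindex [NeZero N] {m : ℕ} (τ : Equiv.Perm (Fin m)) (φ : (ℕ → (Fin m → ZMod N)) → ℤ) :
    EE (fun x => φ (fun k => x k ∘ τ)) = (Equiv.Perm.sign τ : ℤ) * EE φ := by
  unfold EE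
  rw [Finset.mul_sum]
  refine Fintype.sum_equiv (Equiv.arrowCongr τ.symm (Equiv.refl _)) _ _ fun g => ?_
  rw [Finset.mul_sum]
  refine Fintype.sum_equiv (Equiv.mulLeft τ⁻¹) _ _ fun σ => ?_
  have : (fun k => pth g σ k ∘ τ) = pth ((Equiv.arrowCongr τ.symm (Equiv.refl _)) g) (τ⁻¹ * σ) := by
    funext k c
    simp only [pth, Function.comp]
    have : (τ⁻¹ * σ).symm c = σ.symm (τ c) := by
      rw [Equiv.symm_apply_eq]; simp
    rw [this]
    simp [Equiv.arrowCongr]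
  beta_reduce
  rw [this]
  simp only [Equiv.coe_mulLeft, Equiv.Perm.sign_mul, Equiv.Perm.sign_inv, Units.val_mul]
  have : (Equiv.Perm.sign τ : ℤ) * (Equiv.Perm.sign τ : ℤ) = 1 := by
    rcases Int.units_eq_one_or (Equiv.Perm.sign τ) with h | h <;> simp [h]
  linear_combination (-(Equiv.Perm.sign σ : ℤ) * φ (pth ((Equiv.arrowCongr τ.symm (Equiv.refl _)) g) (τ⁻¹ * σ))) * this

def blk (n : ℕ) : Equiv.Perm (Fin (n + n)) := finSumFinEquiv.permCongr (Equiv.sumComm (Fin n) (Fin n))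

theorem sign_blk (n : ℕ) (hn : Even n) : Equiv.Perm.sign (blk n) = 1 := by
  unfold blk
  rw [Equiv.Perm.sign_permCongr]
  have : Equiv.sumComm (Fin n) (Fin n) = (Equiv.boolProdEquivSum (Fin n)).permCongr
      (Equiv.prodCongrLeft (fun _ : Fin n => Equiv.swap false true)) := by
    ext x
    rcases x with x | x <;> simp [Equiv.boolProdEquivSum, Equiv.permCongr_apply]
  have h2 : Equiv.Perm.sign (Equiv.sumComm (Fin n) (Fin n) : Equiv.Perm (Fin n ⊕ Fin n)) = (-1) ^ n := by
    rw [this, Equiv.Perm.sign_permCongr, Equiv.Perm.sign_prodCongrLeft]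
    simp [Equiv.Perm.sign_swap]
  rw [h2, hn.neg_one_pow]


theorem cup_self_zero [NeZero N] (w : ℕ → (Fin (n + n) → ZMod N) → ℤ) (c : Fin (n + n))
    (hw : ∀ i z z', (∀ c', c' ≠ c → z c' = z' c') → w i z = w i z') :
    EE (cup n (aa n w) (aa n w)) = 0 := by
  apply EE_zero
  intro g σ
  set i := σ.symm c with hi
  have hst : w i (pth g σ (i + 1)) = w i (pth g σ i) := by
    apply hw
    intro c' hc'
    apply pth_step
    intro h
    exact hc' (σ.symm.injective (Fin.ext h))
  have hst' : w (i - n) (pth g σ (i + 1)) = w (i - n) (pth g σ i) := by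
    apply hw
    intro c' hc'
    apply pth_step
    intro h
    exact hc' (σ.symm.injective (Fin.ext h))
  unfold cup aa
  by_cases h : i.val < n
  · have : bb n w (pth g σ) = 0 := by
      unfold bb
      apply Finset.prod_eq_zero (Finset.mem_range.2 h)
      rw [hst]; ring
    rw [this]; ring
  · have : bb n w (sh n (pth g σ)) = 0 := by
      unfold bb
      apply Finset.prod_eq_zero (i := i.val - n) (Finset.mem_range.2 (by omega))
      simp only [sh]
      rw [show n + (i.val - n + 1) = i + 1 by omega, show n + (i.val - n) = i by omega, hst']; ring
    rw [this]; ring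

theorem cup_swap [NeZero N] (hn : Even n) (U : ℕ → (Fin n → ZMod N) → ℤ) :
    EE (cup n (aa n (fun i z => U i (rgt z))) (aa n (fun i z => U i (lft z)))) =
    EE (cup n (aa n (fun i z => U i (lft z))) (aa n (fun i z => U i (rgt z)))) := by
  have := EE_reindex (N := N) (blk n)
    (cup n (aa n (fun i z => U i (lft z))) (aa n (fun i z => U i (rgt z))))
  rw [sign_blk n hn] at this
  simp only [Units.val_one, one_mul] at this
  rw [← this]
  have h1 : ∀ z : Fin (n + n) → ZMod N, lft (z ∘ blk n) = rgt z := by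
    intro z; funext i; simp [lft, rgt, blk, Equiv.permCongr_apply]
  have h2 : ∀ z : Fin (n + n) → ZMod N, rgt (z ∘ blk n) = lft z := by
    intro z; funext i
    simp only [lft, rgt, blk, Function.comp, Equiv.permCongr_apply, finSumFinEquiv_symm_apply_natAdd]
    simp
  congr 1
  funext x
  simp only [cup, aa, bb, sh, h1, h2]

theorem cup_prod [NeZero N] (U W : ℕ → (Fin n → ZMod N) → ℤ) :
    EE (cup n (aa n (fun i z => U i (lft z))) (aa n (fun i z => W i (rgt z)))) =
      EE (aa n U) * EE (aa n W) := by
  symm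
  unfold EE
  rw [Fintype.sum_mul_sum, ← Fintype.sum_prod_type']
  refine Fintype.sum_equiv (Fin.appendEquiv n n) _ _ fun g => ?_
  obtain ⟨g₁, g₂⟩ := g
  dsimp only
  rw [Fintype.sum_mul_sum, ← Fintype.sum_prod_type']
  refine Finset.sum_of_injOn (fun s => finSumFinEquiv.permCongr (Equiv.Perm.sumCongr s.1 s.2)) ?_ ?_ ?_ ?_
  · intro s _ t _ h
    have := Equiv.Perm.sumCongrHom_injective (α := Fin n) (β := Fin n) ((finSumFinEquiv.permCongr).injective h)
    exact this
  · intro s _; simp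
  · intro σ _ hσ
    have hnot : ¬ (∀ i : Fin n, (σ (Fin.castAdd n i)).val < n) := by
      intro hall
      apply hσ
      have hm := Equiv.Perm.mem_sumCongrHom_range_of_perm_mapsTo_inl
        (σ := finSumFinEquiv.symm.permCongr σ) (by
          rintro _ ⟨i, rfl⟩
          refine ⟨⟨_, hall i⟩, ?_⟩
          rw [Equiv.permCongr_apply]
          simp only [Equiv.symm_symm, finSumFinEquiv_apply_left]
          rw [Equiv.eq_symm_apply]
          ext; simp)
      obtain ⟨s, hs⟩ := hm
      refine ⟨s, by simp, ?_⟩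
      have hs' : Equiv.Perm.sumCongr s.1 s.2 = finSumFinEquiv.symm.permCongr σ := hs
      dsimp only
      rw [hs']
      ext x; simp [Equiv.permCongr_apply]
    push Not at hnot
    obtain ⟨i, hi⟩ := hnot
    have : bb n (fun i z => U i (lft z)) (pth (Fin.appendEquiv n n (g₁, g₂)) σ) = 0 := by
      unfold bb
      apply Finset.prod_eq_zero (i := i.val) (Finset.mem_range.2 i.2)
      have : lft (pth (Fin.appendEquiv n n (g₁, g₂)) σ (i + 1)) = lft (pth (Fin.appendEquiv n n (g₁, g₂)) σ i) := by
        funext c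
        apply pth_step
        intro h
        have : σ.symm (Fin.castAdd n c) = Fin.castAdd n i := Fin.ext h
        rw [Equiv.symm_apply_eq] at this
        rw [← this] at hi
        simp at hi
        omega
      beta_reduce
      rw [this]; ring
    simp [cup, aa, this]
  · rintro ⟨s₁, s₂⟩ _
    dsimp only
    rw [Equiv.Perm.sign_permCongr, Equiv.Perm.sign_sumCongr]
    set x := pth (Fin.appendEquiv n n (g₁, g₂)) (finSumFinEquiv.permCongr (Equiv.Perm.sumCongr s₁ s₂)) with hx
    have h1 : ∀ k, lft (x k) = pth g₁ s₁ k := by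
      intro k
      funext c
      simp [hx, lft, pth, Fin.appendEquiv, Equiv.permCongr_def]
    have h2 : ∀ k, rgt (x (n + k)) = pth g₂ s₂ k := by
      intro k
      funext c
      simp [hx, rgt, pth, Fin.appendEquiv, Equiv.permCongr_def, -Fin.natAdd_eq_addNat]
    have h3 : aa n (fun i z => U i (lft z)) x = aa n U (pth g₁ s₁) := by
      simp only [aa, bb, h1]
    have h4 : aa n (fun i z => W i (rgt z)) (sh n x) = aa n W (pth g₂ s₂) := by
      simp only [aa, bb, sh, h2]
    simp only [cup]
    rw [h3, h4]
    push_cast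
    ring

end prodeval
end TCS

namespace TCS
section topdeg

abbrev Eu (n : ℕ) := EuclideanSpace ℝ (Fin n)
abbrev Sph (n : ℕ) := Metric.sphere (0 : EuclideanSpace ℝ (Fin (n + 1))) 1
abbrev Tor (m : ℕ) := Fin m → UnitAddCircle

noncomputable def sg {n : ℕ} (y : Eu n) (i : ℕ) : ℤ :=
  if h : i < n then (if 0 < y ⟨i, h⟩ then 1 else 0) else 0

theorem coord_dist {n : ℕ} (y z : Eu n) (i : Fin n) : |y i - z i| ≤ dist y z := by
  rw [dist_eq_norm]
  have := PiLp.norm_apply_le (y - z) i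
  simpa using this

theorem exists_big {n : ℕ} (y : Eu (n + 1)) (hy : ‖y‖ = 1) : ∃ r, 1 / ((n : ℝ) + 1) ≤ |y r| := by
  by_contra hcon
  push Not at hcon
  have h1 : ‖y‖ ^ 2 = ∑ i, |y i| ^ 2 := by
    rw [EuclideanSpace.norm_sq_eq]; simp
  have h2 : ∑ i : Fin (n + 1), |y i| ^ 2 < ∑ i : Fin (n + 1), 1 / ((n : ℝ) + 1) := by
    apply Finset.sum_lt_sum_of_nonempty (by simp)
    intro i _
    have := hcon i
    have h3 : 1 / ((n : ℝ) + 1) ≤ 1 := by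
      rw [div_le_one (by positivity)]; linarith [(Nat.cast_nonneg n : (0:ℝ) ≤ n)]
    nlinarith [abs_nonneg (y i)]
  rw [← h1, hy] at h2
  simp at h2
  rw [mul_inv_cancel₀ (by positivity)] at h2
  exact lt_irrefl _ h2

theorem nearconst {n : ℕ} (y : Eu (n + 1)) (hy : ‖y‖ = 1) :
    ∃ r < n + 1, ∀ z : Eu (n + 1), dist y z < 1 / ((n : ℝ) + 1) → sg z r = sg y r := by
  obtain ⟨r, hr⟩ := exists_big y hy
  refine ⟨r, r.2, fun z hz => ?_⟩
  have h := (coord_dist y z r).trans_lt hz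
  simp only [sg, r.2, dif_pos]
  have : (0 < z r) ↔ (0 < y r) := by
    rw [abs_lt] at h
    rcases le_abs.1 hr with h' | h' <;> constructor <;> intro h3 <;> linarith
  simp [this]

theorem tele {V : Type*} (q M : ℕ) (G : ℕ → V → Eu (q + 2)) (P : (ℕ → V) → Prop)
    (h : ∀ x, P x → ∀ k < M, ‖G k (x 0)‖ = 1 ∧ ∀ i, dist (G k (x 0)) (G k (x i)) < 1 / ((q : ℝ) + 2)
      ∧ dist (G k (x 0)) (G (k + 1) (x i)) < 1 / ((q : ℝ) + 2)) :
    ∃ β, Dep q β ∧ ∀ x, P x → aa (q + 1) (fun i z => sg (G 0 z) i) x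
      - aa (q + 1) (fun i z => sg (G M z) i) x = dl q β x := by
  induction M with
  | zero => exact ⟨fun _ => 0, fun _ _ _ => rfl, fun x _ => by simp [dl]⟩
  | succ M ih =>
    obtain ⟨β, hβ, hβ'⟩ := ih (fun x hx k hk => h x hx k (by omega))
    obtain ⟨β₂, hβ₂, hβ₂'⟩ := contig q (fun i z => sg (G M z) i) (fun i z => sg (G (M + 1) z) i) P (by
      intro x hx
      obtain ⟨h1, h2⟩ := h x hx M (by omega)
      obtain ⟨r, hr, hr'⟩ := nearconst (n := q + 1) _ h1
      have e : ((q + 1 : ℕ) : ℝ) + 1 = (q : ℝ) + 2 := by push_cast; ring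
      refine ⟨r, by omega, _, fun i => ⟨hr' _ ?_, hr' _ ?_⟩⟩
      · rw [e]; exact (h2 i).1
      · rw [e]; exact (h2 i).2)
    refine ⟨fun x => β x + β₂ x, ?_, ?_⟩
    · intro x y hxy; simp only; rw [hβ x y hxy, hβ₂ x y hxy]
    · intro x hx
      rw [dl_add, ← hβ' x hx, ← hβ₂' x hx]; ring

noncomputable def grid {m N : ℕ} [NeZero N] (z : Fin m → ZMod N) : Tor m :=
  fun c => ZMod.toAddCircle (z c)

noncomputable def uu {m n N : ℕ} [NeZero N] (F : Tor m → Sph n) : ℕ → (Fin m → ZMod N) → ℤ :=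
  fun i z => sg (F (grid z) : Eu (n + 1)) i

theorem uu_big {m n N : ℕ} [NeZero N] (F : Tor m → Sph n) (i : ℕ) (hi : n < i) :
   (uu F i : (Fin m → ZMod N) → ℤ) = 0 := by
  funext z
  simp only [uu, sg]
  rw [dif_neg (by omega)]; rfl

noncomputable def deg {n : ℕ} (M : ℕ) (F : Tor n → Sph n) : ℤ := EE (N := M + 1) (aa n (uu F))

theorem htpy (q m : ℕ) (F₀ F₁ : C(Tor m, Sph (q + 1))) (K : Set (Tor m)) (hK : IsClosed K)
    (H : (F₀.restrict K).Homotopic (F₁.restrict K)) :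
    ∃ δ > (0:ℝ), ∀ (N : ℕ) [NeZero N], ∃ β : (ℕ → (Fin m → ZMod N)) → ℤ, Dep q β ∧
      ∀ x, (∀ i, grid (x i) ∈ K) → (∀ i j, dist (grid (x i)) (grid (x j)) < δ) →
      aa (q + 1) (uu F₀) x - aa (q + 1) (uu F₁) x = dl q β x := by
  classical
  obtain ⟨H⟩ := H
  have : CompactSpace K := isCompact_iff_compactSpace.1 hK.isCompact
  have huc : UniformContinuous (fun p : unitInterval × K => (H p : Eu (q + 2))) :=
    CompactSpace.uniformContinuous_of_continuous (by fun_prop)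
  rw [Metric.uniformContinuous_iff] at huc
  obtain ⟨δ, hδ, hδ'⟩ := huc (1 / ((q : ℝ) + 2)) (by positivity)
  refine ⟨δ, hδ, ?_⟩
  intro N _
  obtain ⟨M, hM⟩ := exists_nat_gt (1 / δ)
  have hMpos : (0 : ℝ) < M := lt_trans (by positivity) hM
  have hM' : 1 / (M : ℝ) < δ := by
    rw [div_lt_iff₀ hMpos]; rw [div_lt_iff₀ hδ] at hM; linarith
  let tm : ℕ → unitInterval := fun k => Set.projIcc 0 1 zero_le_one ((k : ℝ) / M)
  have htm : ∀ k, dist (tm k) (tm (k + 1)) < δ := by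
    intro k
    refine lt_of_le_of_lt ?_ hM'
    have h1 := (LipschitzWith.projIcc (zero_le_one (α := ℝ))).dist_le_mul ((k : ℝ) / M) (((k + 1 : ℕ) : ℝ) / M)
    refine h1.trans ?_
    rw [Real.dist_eq, ← sub_div]
    push_cast
    rw [show (k : ℝ) - (k + 1) = -1 by ring, abs_div]
    simp
  have htm0 : tm 0 = 0 := by simp [tm]
  have htmM : tm M = 1 := by
    simp only [tm]; rw [div_self hMpos.ne']; simp
  let G : ℕ → (Fin m → ZMod N) → Eu (q + 2) := fun k z =>
    if h : grid z ∈ K then (H (tm k, ⟨grid z, h⟩) : Eu (q + 2)) else 0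
  obtain ⟨β, hβ, hβ'⟩ := tele q M G (fun x => (∀ i, grid (x i) ∈ K) ∧ (∀ i j, dist (grid (x i)) (grid (x j)) < δ)) (by
    rintro x ⟨hx1, hx2⟩ k hk
    simp only [G, hx1, dif_pos]
    refine ⟨by simp, fun i => ⟨hδ' ?_, hδ' ?_⟩⟩
    · rw [Prod.dist_eq, max_lt_iff]
      exact ⟨by simpa using hδ, hx2 0 i⟩
    · rw [Prod.dist_eq, max_lt_iff]
      exact ⟨htm k, hx2 0 i⟩)
  refine ⟨β, hβ, fun x hx1 hx2 => ?_⟩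
  rw [← hβ' x ⟨hx1, hx2⟩]
  congr 1
  · simp only [aa, bb, uu, G, hx1, dif_pos, htm0]
    simp
  · simp only [aa, bb, uu, G, hx1, dif_pos, htmM]
    simp

end topdeg
end TCS

namespace TCS
section partB

theorem pth_dist {m N : ℕ} [NeZero N] (g : Fin m → ZMod N) (σ : Equiv.Perm (Fin m)) (i j : ℕ) :
    dist (grid (pth g σ i)) (grid (pth g σ j)) ≤ 1 / (N : ℝ) := by
  rw [dist_pi_le_iff (by positivity)]
  intro c
  have h1 : ‖(ZMod.toAddCircle (1 : ZMod N))‖ ≤ 1 / (N : ℝ) := by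
    have := ZMod.toAddCircle_natCast (N := N) 1
    rw [Nat.cast_one] at this
    rw [this, Nat.cast_one]
    refine (QuotientAddGroup.norm_mk_le_norm (S := AddSubgroup.zmultiples (1:ℝ)) (m := (1 / N : ℝ))).trans ?_
    rw [Real.norm_eq_abs, abs_of_nonneg (by positivity)]
  simp only [grid, pth, dist_eq_norm]
  rw [← map_sub]
  split_ifs
  · simp
  · simpa using h1
  · have : g c + 0 - (g c + 1) = -1 := by ring
    rw [this, map_neg, norm_neg]; exact h1
  · simp

theorem deg_inv {q : ℕ} (F F' : C(Tor (q + 1), Sph (q + 1))) (h : F.Homotopic F') :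
    ∀ᶠ M in Filter.atTop, deg M F = deg M F' := by
  obtain ⟨δ, hδ, hβ⟩ := htpy q (q + 1) F F' univ isClosed_univ (by
    obtain ⟨H⟩ := h
    exact ⟨H.comp (ContinuousMap.Homotopy.refl ⟨Subtype.val, continuous_subtype_val⟩)⟩)
  filter_upwards [tendsto_one_div_add_atTop_nhds_zero_nat (𝕜 := ℝ) |>.eventually (gt_mem_nhds hδ)] with M hM
  obtain ⟨β, h1, h2⟩ := hβ (M + 1)
  unfold deg
  rw [← sub_eq_zero, ← EE_sub, EE_congr _ (dl q β), stokes q (M + 1) β h1]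
  intro g σ
  apply h2
  · intro i; trivial
  · intro i j
    refine (pth_dist _ _ _ _).trans_lt ?_
    push_cast
    exact hM

def pL (n : ℕ) : C(Tor (n + n), Tor n) := ⟨fun z i => z (Fin.castAdd n i), by fun_prop⟩
def pR (n : ℕ) : C(Tor (n + n), Tor n) := ⟨fun z i => z (Fin.natAdd n i), by fun_prop⟩

theorem bb_small {m q : ℕ} (F : C(Tor m, Sph (q + 1))) : ∃ δ > (0 : ℝ), ∀ (N : ℕ) [NeZero N]
    (x : ℕ → (Fin m → ZMod N)), (∀ i j, dist (grid (x i)) (grid (x j)) < δ) →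
    dl (q + 1) (aa (q + 1) (uu F)) x = 0 := by
  have huc : UniformContinuous (fun p => (F p : Eu (q + 2))) :=
    CompactSpace.uniformContinuous_of_continuous (by fun_prop)
  rw [Metric.uniformContinuous_iff] at huc
  obtain ⟨δ, hδ, hδ'⟩ := huc (1 / (((q + 1 : ℕ) : ℝ) + 1)) (by positivity)
  refine ⟨δ, hδ, fun N _ x hx => ?_⟩
  rw [dl_aa]
  obtain ⟨r, hr, hr'⟩ := nearconst (n := q + 1) (F (grid (x 0)) : Eu (q + 2)) (by simp)
  have : bb (q + 1 + 1) (uu F) x = 0 := by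
    unfold bb
    apply Finset.prod_eq_zero (i := r) (by simpa using hr)
    have h1 : ∀ i, uu F r (x i) = uu F r (x 0) := fun i => hr' _ (hδ' (hx 0 i))
    rw [h1, h1 r]; ring
  rw [this, mul_zero]

theorem partB {q : ℕ} (hq : Even (q + 1)) (F : C(Tor (q + 1), Sph (q + 1)))
    (U₁ U₂ : Set (Tor ((q + 1) + (q + 1)))) (ho₁ : IsOpen U₁) (ho₂ : IsOpen U₂) (hc : U₁ ∪ U₂ = univ)
    (H₁ : ((F.comp (pL (q + 1))).restrict U₁).Homotopic ((F.comp (pR (q + 1))).restrict U₁))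
    (H₂ : ((F.comp (pL (q + 1))).restrict U₂).Homotopic ((F.comp (pR (q + 1))).restrict U₂)) :
    ∀ᶠ M in Filter.atTop, deg M F = 0 := by
  obtain ⟨K₁, hK₁, hKc, hK₁U⟩ : ∃ K : Set (Tor ((q + 1) + (q + 1))), IsOpen K ∧ K ∪ U₂ = univ ∧ closure K ⊆ U₁ := by
    have h1 : U₂ᶜ ⊆ U₁ := by
      intro x hx
      have : x ∈ U₁ ∪ U₂ := hc ▸ mem_univ x
      exact this.resolve_right hx
    obtain ⟨K, h2, h3, h4⟩ := normal_exists_closure_subset ho₂.isClosed_compl ho₁ h1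
    refine ⟨K, h2, ?_, h4⟩
    rw [eq_univ_iff_forall]
    intro x
    by_cases hx : x ∈ U₂
    · exact Or.inr hx
    · exact Or.inl (h3 hx)
  obtain ⟨K₂, hK₂, hKc₂, hK₂U⟩ : ∃ K : Set (Tor ((q + 1) + (q + 1))), IsOpen K ∧ K₁ ∪ K = univ ∧ closure K ⊆ U₂ := by
    have h1 : K₁ᶜ ⊆ U₂ := by
      intro x hx
      have : x ∈ K₁ ∪ U₂ := hKc ▸ mem_univ x
      exact this.resolve_left hx
    obtain ⟨K, h2, h3, h4⟩ := normal_exists_closure_subset hK₁.isClosed_compl ho₂ h1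
    refine ⟨K, h2, ?_, h4⟩
    rw [eq_univ_iff_forall]
    intro x
    by_cases hx : x ∈ K₁
    · exact Or.inl hx
    · exact Or.inr (h3 hx)
  have resH : ∀ {K U : Set (Tor ((q + 1) + (q + 1)))}, K ⊆ U →
    ((F.comp (pL (q + 1))).restrict U).Homotopic ((F.comp (pR (q + 1))).restrict U) →
    ((F.comp (pL (q + 1))).restrict K).Homotopic ((F.comp (pR (q + 1))).restrict K) := by
    rintro K U hKU ⟨H⟩
    exact ⟨H.comp (ContinuousMap.Homotopy.refl ⟨Set.inclusion hKU, continuous_inclusion hKU⟩)⟩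
  obtain ⟨δ₁, hδ₁, hβ₁⟩ := htpy q _ _ _ (closure K₁) isClosed_closure (resH hK₁U H₁)
  obtain ⟨δ₂, hδ₂, hβ₂⟩ := htpy q _ _ _ (closure K₂) isClosed_closure (resH hK₂U H₂)
  obtain ⟨δ₃, hδ₃, hδ₃'⟩ := bb_small (F.comp (pL (q + 1)))
  obtain ⟨δ₄, hδ₄, hδ₄'⟩ := bb_small (F.comp (pR (q + 1)))
  obtain ⟨δ₅, hδ₅, hδ₅'⟩ := lebesgue_number_lemma_of_metric (s := (univ : Set (Tor ((q + 1) + (q + 1)))))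
    (c := fun b : Bool => if b then K₁ else K₂) isCompact_univ (by
      intro b; cases b <;> simpa) (by
      rw [← hKc₂]
      rintro x (hx | hx)
      · exact mem_iUnion.2 ⟨true, by simpa⟩
      · exact mem_iUnion.2 ⟨false, by simpa⟩)
  have hδ : 0 < min δ₁ (min δ₂ (min δ₃ (min δ₄ δ₅))) := by simp [*]
  filter_upwards [tendsto_one_div_add_atTop_nhds_zero_nat (𝕜 := ℝ) |>.eventually (gt_mem_nhds hδ)] with M hM
  have hd : ∀ g σ i j, dist (grid (N := M + 1) (pth g σ i : Fin ((q + 1) + (q + 1)) → _)) (grid (pth g σ j)) < min δ₁ (min δ₂ (min δ₃ (min δ₄ δ₅))) := by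
    intro g σ i j
    refine (pth_dist _ _ _ _).trans_lt ?_
    push_cast
    exact hM
  simp only [lt_min_iff] at hd
  obtain ⟨β₁, hd₁, hb₁⟩ := hβ₁ (M + 1)
  obtain ⟨β₂, hd₂, hb₂⟩ := hβ₂ (M + 1)
  set a : (ℕ → (Fin ((q + 1) + (q + 1)) → ZMod (M + 1))) → ℤ := aa (q + 1) (uu (F.comp (pL (q + 1)))) with ha
  set b : (ℕ → (Fin ((q + 1) + (q + 1)) → ZMod (M + 1))) → ℤ := aa (q + 1) (uu (F.comp (pR (q + 1)))) with hb
  have hmain := main_cup q (M + 1) (fun x => a x - b x) β₁ β₂ (by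
      intro x y hxy
      have h1 : a x = a y := dep_aa _ _ x y hxy
      have h2 : b x = b y := dep_aa _ _ x y hxy
      simp only [h1, h2]) hd₁ hd₂ (by
      intro g σ p
      have h1 : dl (q + 1) a (sh p (pth g σ)) = 0 :=
        hδ₃' _ _ (fun i j => (hd g σ (p + i) (p + j)).2.2.1)
      have h2 : dl (q + 1) b (sh p (pth g σ)) = 0 :=
        hδ₄' _ _ (fun i j => (hd g σ (p + i) (p + j)).2.2.2.1)
      rw [dl_sub, h1, h2]; rfl) (by
      intro g σ
      obtain ⟨t, ht⟩ := hδ₅' (grid (pth g σ 0)) (mem_univ _)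
      have ht' : ∀ i, grid (pth g σ i) ∈ (if t then K₁ else K₂) := fun i => ht (hd g σ i 0).2.2.2.2
      cases t
      · right
        exact hb₂ _ (fun i => subset_closure (ht' _)) (fun i j => (hd _ _ _ _).2.1)
      · left
        exact hb₁ _ (fun i => subset_closure (ht' _)) (fun i j => (hd _ _ _ _).1))
  have e1 : EE (cup (q + 1) a a) = 0 := by
    apply cup_self_zero _ (Fin.natAdd (q + 1) 0)
    intro i z z' hz
    have : pL (q + 1) (grid z) = pL (q + 1) (grid z') := by
      funext c
      simp only [pL, grid, ContinuousMap.coe_mk]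
      rw [hz]
      intro h
      have := congrArg Fin.val h
      simp at this; omega
    simp only [uu, ContinuousMap.comp_apply, this]
  have e2 : EE (cup (q + 1) b b) = 0 := by
    apply cup_self_zero _ (Fin.castAdd (q + 1) 0)
    intro i z z' hz
    have : pR (q + 1) (grid z) = pR (q + 1) (grid z') := by
      funext c
      simp only [pR, grid, ContinuousMap.coe_mk]
      rw [hz]
      intro h
      have := congrArg Fin.val h
      simp at this
    simp only [uu, ContinuousMap.comp_apply, this]
  have hua : a = aa (q + 1) (fun i z => uu F i (lft z)) := rfl
  have hub : b = aa (q + 1) (fun i z => uu F i (rgt z)) := rfl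
  have e3 : EE (cup (q + 1) a b) = deg M F * deg M F := by
    rw [hua, hub]; exact cup_prod _ _
  have e4 : EE (cup (q + 1) b a) = deg M F * deg M F := by
    rw [← e3, hua, hub]; exact cup_swap hq _
  have e5 : EE (cup (q + 1) (fun x => a x - b x) (fun x => a x - b x)) =
      EE (cup (q + 1) a a) - EE (cup (q + 1) a b) - EE (cup (q + 1) b a) + EE (cup (q + 1) b b) := by
    rw [← EE_sub, ← EE_sub, ← EE_add]
    apply EE_congr
    intro g σ
    simp only [cup]; ring
  rw [e5, e1, e2, e3, e4] at hmain
  have : deg M F * deg M F = 0 := by linarith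
  simpa using this

end partB
end TCS

namespace TCS
section tools
variable {X : Type*} [TopologicalSpace X] {n : ℕ}

theorem nrm_mem (v : Eu (n + 1)) (h : v ≠ 0) : ‖v‖⁻¹ • v ∈ Metric.sphere (0 : Eu (n + 1)) 1 := by
  rw [mem_sphere_zero_iff_norm, norm_smul, norm_inv, norm_norm, inv_mul_cancel₀ (norm_ne_zero_iff.2 h)]

noncomputable def mkS (F : X → Eu (n + 1)) (hc : Continuous F) (hne : ∀ x, F x ≠ 0) : C(X, Sph n) where
  toFun x := ⟨‖F x‖⁻¹ • F x, nrm_mem _ (hne x)⟩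
  continuous_toFun := Continuous.subtype_mk ((hc.norm.inv₀ (fun x => norm_ne_zero_iff.2 (hne x))).smul hc) _

theorem mkS_coe (F : X → Eu (n + 1)) (hc : Continuous F) (hne : ∀ x, F x ≠ 0) (x : X) :
    (mkS F hc hne x : Eu (n + 1)) = ‖F x‖⁻¹ • F x := rfl

theorem mkS_pos (F : X → Eu (n + 1)) (hc : Continuous F) (hne : ∀ x, F x ≠ 0) (x : X) :
    ∃ c > (0 : ℝ), F x = c • (mkS F hc hne x : Eu (n + 1)) :=
  ⟨‖F x‖, norm_pos_iff.2 (hne x), by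
    rw [mkS_coe, smul_smul, mul_inv_cancel₀ (norm_ne_zero_iff.2 (hne x)), one_smul]⟩

theorem sph_norm (y : Sph n) : ‖(y : Eu (n + 1))‖ = 1 := by simp

theorem sph_ne (y : Sph n) : (y : Eu (n + 1)) ≠ 0 := by
  intro h
  have := sph_norm y
  rw [h, norm_zero] at this
  exact zero_ne_one this

theorem pos_unique {y : Sph n} {v : Eu (n + 1)} (h : ∃ c > (0 : ℝ), v = c • (y : Eu (n + 1))) :
    ‖v‖⁻¹ • v = y := by
  obtain ⟨c, hc, rfl⟩ := h
  rw [norm_smul, sph_norm, mul_one, Real.norm_eq_abs, abs_of_pos hc, smul_smul, inv_mul_cancel₀ hc.ne', one_smul]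

theorem hom_of (f₀ f₁ : C(X, Sph n)) (H : unitInterval × X → Eu (n + 1)) (hc : Continuous H)
    (hne : ∀ p, H p ≠ 0) (h0 : ∀ x, ∃ c > (0 : ℝ), H (0, x) = c • (f₀ x : Eu (n + 1)))
    (h1 : ∀ x, ∃ c > (0 : ℝ), H (1, x) = c • (f₁ x : Eu (n + 1))) : f₀.Homotopic f₁ := by
  refine ⟨⟨mkS H hc hne, ?_, ?_⟩⟩
  · intro x; apply Subtype.ext; exact pos_unique (h0 x)
  · intro x; apply Subtype.ext; exact pos_unique (h1 x)

theorem hom_line (f₀ f₁ : C(X, Sph n)) (F₀ F₁ : X → Eu (n + 1)) (hc₀ : Continuous F₀) (hc₁ : Continuous F₁)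
    (hne : ∀ t : ℝ, 0 ≤ t → t ≤ 1 → ∀ x, (1 - t) • F₀ x + t • F₁ x ≠ 0)
    (h0 : ∀ x, ∃ c > (0 : ℝ), F₀ x = c • (f₀ x : Eu (n + 1)))
    (h1 : ∀ x, ∃ c > (0 : ℝ), F₁ x = c • (f₁ x : Eu (n + 1))) : f₀.Homotopic f₁ := by
  refine hom_of f₀ f₁ (fun p => (1 - (p.1 : ℝ)) • F₀ p.2 + (p.1 : ℝ) • F₁ p.2) (by fun_prop)
    (fun p => hne p.1 p.1.2.1 p.1.2.2 p.2) ?_ ?_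
  · intro x; simpa using h0 x
  · intro x; simpa using h1 x

theorem hom_near (f₀ f₁ : C(X, Sph n)) (F₁ : X → Eu (n + 1)) (hc₁ : Continuous F₁)
    (h1 : ∀ x, ∃ c > (0 : ℝ), F₁ x = c • (f₁ x : Eu (n + 1)))
    (hd : ∀ x, ‖(f₀ x : Eu (n + 1)) - F₁ x‖ < 1) : f₀.Homotopic f₁ := by
  refine hom_line f₀ f₁ (fun x => (f₀ x : Eu (n + 1))) F₁ (by fun_prop) hc₁ ?_ (fun x => ⟨1, one_pos, by simp⟩) h1
  intro t ht0 ht1 x h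
  have e : (f₀ x : Eu (n + 1)) = t • ((f₀ x : Eu (n + 1)) - F₁ x) := by
    rw [smul_sub, ← sub_eq_zero, ← h]; module
  have := congrArg norm e
  rw [sph_norm, norm_smul, Real.norm_eq_abs, abs_of_nonneg ht0] at this
  nlinarith [hd x, norm_nonneg ((f₀ x : Eu (n + 1)) - F₁ x)]

theorem hom_antip (f₀ f₁ : C(X, Sph n)) (h : ∀ x, (f₀ x : Eu (n + 1)) ≠ - (f₁ x : Eu (n + 1))) :
    f₀.Homotopic f₁ := by
  refine hom_line f₀ f₁ (fun x => (f₀ x : Eu (n + 1))) (fun x => (f₁ x : Eu (n + 1))) (by fun_prop) (by fun_prop)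
    ?_ (fun x => ⟨1, one_pos, by simp⟩) (fun x => ⟨1, one_pos, by simp⟩)
  intro t ht0 ht1 x hx
  have e := eq_neg_of_add_eq_zero_left hx
  have e2 := congrArg norm e
  rw [norm_neg, norm_smul, norm_smul, sph_norm, sph_norm, Real.norm_eq_abs, Real.norm_eq_abs,
    abs_of_nonneg ht0, abs_of_nonneg (by linarith)] at e2
  have ht : t = 1 / 2 := by linarith
  apply h x
  have e3 := congrArg (fun v => (2 : ℝ) • v) hx
  simp only [smul_add, smul_smul, smul_zero, ht] at e3
  norm_num at e3
  exact eq_neg_of_add_eq_zero_left e3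

def cns (a : ℝ) (v : Eu n) : Eu (n + 1) := WithLp.toLp 2 (Fin.cons a v.ofLp)
def tl (x : Eu (n + 1)) : Eu n := WithLp.toLp 2 (fun i => x i.succ)

@[simp] theorem cns_zero (a : ℝ) (v : Eu n) : (cns a v) 0 = a := rfl
@[simp] theorem cns_succ (a : ℝ) (v : Eu n) (i : Fin n) : (cns a v) i.succ = v i := rfl
@[simp] theorem tl_apply (x : Eu (n + 1)) (i : Fin n) : tl x i = x i.succ := rfl
@[simp] theorem tl_cns (a : ℝ) (v : Eu n) : tl (cns a v) = v := rfl
@[simp] theorem cns_tl (x : Eu (n + 1)) : cns (x 0) (tl x) = x := by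
  ext i; refine Fin.cases ?_ (fun i => ?_) i <;> simp

theorem cns_cont : Continuous (fun p : ℝ × Eu n => cns p.1 p.2) := by
  refine (PiLp.continuous_toLp 2 _).comp (continuous_pi fun i => ?_)
  refine Fin.cases ?_ (fun i => ?_) i
  · simpa using continuous_fst
  · simp only [Fin.cons_succ]; fun_prop

@[fun_prop] theorem cns_cont2 {Y : Type*} [TopologicalSpace Y] {a : Y → ℝ} {v : Y → Eu n}
    (ha : Continuous a) (hv : Continuous v) : Continuous (fun y => cns (a y) (v y)) :=
  cns_cont.comp (ha.prodMk hv)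

@[fun_prop] theorem tl_cont : Continuous (tl : Eu (n + 1) → Eu n) := by
  refine (PiLp.continuous_toLp 2 _).comp (continuous_pi fun i => ?_)
  fun_prop

theorem norm_sq_cns (x : Eu (n + 1)) : ‖x‖ ^ 2 = x 0 ^ 2 + ‖tl x‖ ^ 2 := by
  rw [EuclideanSpace.norm_sq_eq, EuclideanSpace.norm_sq_eq, Fin.sum_univ_succ]
  simp

theorem tl_add (x y : Eu (n + 1)) : tl (x + y) = tl x + tl y := rfl
theorem tl_sub (x y : Eu (n + 1)) : tl (x - y) = tl x - tl y := rfl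
theorem tl_smul (c : ℝ) (x : Eu (n + 1)) : tl (c • x) = c • tl x := rfl

theorem eq_zero_iff (x : Eu (n + 1)) : x = 0 ↔ x 0 = 0 ∧ tl x = 0 := by
  constructor
  · rintro rfl; exact ⟨rfl, rfl⟩
  · rintro ⟨h1, h2⟩
    rw [← cns_tl x, h1, h2]
    ext i; refine Fin.cases ?_ (fun i => ?_) i <;> simp

theorem sph_eq (x : Sph n) : (x : Eu (n + 1)) 0 ^ 2 + ‖tl (x : Eu (n + 1))‖ ^ 2 = 1 := by
  rw [← norm_sq_cns, sph_norm]; norm_num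

theorem nullhom_of {f g : C(X, Sph n)} (h : f.Homotopic g) (hg : g.Nullhomotopic) : f.Nullhomotopic := by
  obtain ⟨y, hy⟩ := hg
  exact ⟨y, h.trans hy⟩

end tools

section susp
variable {X : Type*} [TopologicalSpace X] {m : ℕ}

noncomputable def ptS (m : ℕ) : Sph m := ⟨EuclideanSpace.single 0 1, by simp⟩

open Classical in
noncomputable def nrm (v : Eu (m + 1)) : Sph m :=
  if h : v = 0 then ptS m else ⟨‖v‖⁻¹ • v, nrm_mem v h⟩

theorem nrm_contAt (v : Eu (m + 1)) (hv : v ≠ 0) : ContinuousAt nrm v := by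
  rw [Topology.IsInducing.subtypeVal.continuousAt_iff]
  have : ContinuousAt (fun v : Eu (m + 1) => ‖v‖⁻¹ • v) v :=
    (continuousAt_id.norm.inv₀ (norm_ne_zero_iff.2 hv)).smul continuousAt_id
  refine this.congr ?_
  filter_upwards [isOpen_ne.mem_nhds hv] with w hw
  have hw' : w ≠ 0 := hw
  simp [nrm, hw']

theorem nrm_smul (c : ℝ) (hc : 0 < c) (y : Sph m) : nrm (c • (y : Eu (m + 1))) = y := by
  have h : c • (y : Eu (m + 1)) ≠ 0 := smul_ne_zero hc.ne' (sph_ne y)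
  unfold nrm
  rw [dif_neg h]
  apply Subtype.ext
  exact pos_unique ⟨c, hc, rfl⟩

noncomputable def ext (G : X × Sph m → Sph m) (p : X × Eu (m + 1)) : Eu (m + 1) :=
  ‖p.2‖ • (G (p.1, nrm p.2) : Eu (m + 1))

theorem ext_norm (G : X × Sph m → Sph m) (p : X × Eu (m + 1)) : ‖ext G p‖ = ‖p.2‖ := by
  simp [ext, norm_smul]

theorem ext_zero (G : X × Sph m → Sph m) (x : X) : ext G (x, 0) = 0 := by
  simp [ext]

theorem ext_smul (G : X × Sph m → Sph m) (x : X) (c : ℝ) (hc : 0 ≤ c) (y : Sph m) :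
    ext G (x, c • (y : Eu (m + 1))) = c • (G (x, y) : Eu (m + 1)) := by
  rcases hc.eq_or_lt with rfl | hc
  · simp [ext]
  · simp only [ext]
    rw [nrm_smul c hc, norm_smul, sph_norm, mul_one, Real.norm_eq_abs, abs_of_pos hc]

theorem ext_cont (G : X × Sph m → Sph m) (hG : Continuous G) : Continuous (ext G) := by
  rw [continuous_iff_continuousAt]
  rintro ⟨x, v⟩
  by_cases hv : v = 0
  · subst hv
    unfold ContinuousAt
    rw [ext_zero]
    refine squeeze_zero_norm (a := fun p => ‖p.2‖) (fun p => (ext_norm G p).le) ?_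
    have : Continuous (fun p : X × Eu (m + 1) => ‖p.2‖) := by fun_prop
    simpa using this.tendsto (x, 0)
  · have h1 : ContinuousAt (fun p : X × Eu (m + 1) => (p.1, nrm p.2)) (x, v) :=
      continuousAt_fst.prodMk (ContinuousAt.comp' (f := Prod.snd) (g := nrm) (nrm_contAt v hv) continuousAt_snd)
    have h2 : ContinuousAt (fun p : X × Eu (m + 1) => (G (p.1, nrm p.2) : Eu (m + 1))) (x, v) :=
      ContinuousAt.comp' (g := fun q => (G q : Eu (m + 1))) (continuous_subtype_val.comp hG).continuousAt h1
    exact (continuousAt_snd.norm).smul h2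

noncomputable def ext1 (g : C(Sph m, Sph m)) (v : Eu (m + 1)) : Eu (m + 1) :=
  ext (X := Unit) (fun p => g p.2) ((), v)

theorem ext1_cont (g : C(Sph m, Sph m)) : Continuous (ext1 g) :=
  (ext_cont _ (by fun_prop)).comp (by fun_prop)

theorem ext1_smul (g : C(Sph m, Sph m)) (c : ℝ) (hc : 0 ≤ c) (y : Sph m) :
    ext1 g (c • (y : Eu (m + 1))) = c • (g y : Eu (m + 1)) := ext_smul _ _ c hc y

theorem ext1_norm (g : C(Sph m, Sph m)) (v : Eu (m + 1)) : ‖ext1 g v‖ = ‖v‖ := ext_norm _ _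

theorem susp_mem (g : C(Sph m, Sph m)) (x : Sph (m + 1)) :
    cns ((x : Eu (m + 2)) 0) (ext1 g (tl (x : Eu (m + 2)))) ∈ Metric.sphere (0 : Eu (m + 2)) 1 := by
  rw [mem_sphere_zero_iff_norm, ← sq_eq_sq₀ (norm_nonneg _) zero_le_one, norm_sq_cns]
  simp only [cns_zero, tl_cns, ext1_norm]
  rw [sph_eq]; norm_num

theorem susp_cont (g : C(Sph m, Sph m)) : Continuous (fun x : Sph (m + 1) =>
    cns ((x : Eu (m + 2)) 0) (ext1 g (tl (x : Eu (m + 2))))) := by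
  have := ext1_cont g
  exact cns_cont2 (by fun_prop) (this.comp (by fun_prop))

noncomputable def susp (g : C(Sph m, Sph m)) : C(Sph (m + 1), Sph (m + 1)) where
  toFun x := ⟨cns ((x : Eu (m + 2)) 0) (ext1 g (tl (x : Eu (m + 2)))), susp_mem g x⟩
  continuous_toFun := (susp_cont g).subtype_mk _

theorem susp_coe (g : C(Sph m, Sph m)) (x : Sph (m + 1)) :
    (susp g x : Eu (m + 2)) = cns ((x : Eu (m + 2)) 0) (ext1 g (tl (x : Eu (m + 2)))) := rfl

theorem susp_null (g : C(Sph m, Sph m)) (hg : g.Nullhomotopic) : (susp g).Nullhomotopic := by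
  obtain ⟨c, ⟨H⟩⟩ := hg
  have hcc := ext_cont (fun p : unitInterval × Sph m => H p) (by fun_prop)
  let K : unitInterval × Sph (m + 1) → Eu (m + 2) := fun p =>
    cns ((p.2 : Eu (m + 2)) 0) (ext (fun p : unitInterval × Sph m => H p) (p.1, tl (p.2 : Eu (m + 2))))
  have hK : Continuous K := cns_cont2 (by fun_prop) (hcc.comp (by fun_prop))
  have hKne : ∀ p, K p ≠ 0 := by
    intro p h
    have : ‖K p‖ ^ 2 = 1 := by
      rw [norm_sq_cns]; simp only [K, cns_zero, tl_cns, ext_norm]; exact sph_eq p.2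
    rw [h] at this; simp at this
  have hc : ∀ x : Sph (m + 1), K (1, x) = cns ((x : Eu (m + 2)) 0) (‖tl (x : Eu (m + 2))‖ • (c : Eu (m + 1))) := by
    intro x; simp [K, ext]
  have hmid : Continuous (fun x : Sph (m + 1) => K (1, x)) := hK.comp (by fun_prop)
  have h1 : (susp g).Homotopic (mkS (fun x => K (1, x)) hmid (fun x => hKne _)) := by
    refine hom_of _ _ K hK hKne (fun x => ⟨1, one_pos, ?_⟩) (fun x => mkS_pos (fun x => K (1, x)) hmid (fun x => hKne _) x)
    rw [one_smul, susp_coe]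
    simp [K, ext, ext1]
  refine nullhom_of h1 ⟨⟨cns 0 (c : Eu (m + 1)), ?_⟩, ?_⟩
  · rw [mem_sphere_zero_iff_norm, ← sq_eq_sq₀ (norm_nonneg _) zero_le_one, norm_sq_cns]
    simp
  · refine hom_line _ _ (fun x => K (1, x)) (fun _ => cns 0 (c : Eu (m + 1))) hmid continuous_const ?_
      (fun x => mkS_pos (fun x => K (1, x)) hmid (fun x => hKne _) x) (fun x => ⟨1, one_pos, by simp⟩)
    intro t ht0 ht1 x h
    rw [eq_zero_iff] at h
    simp only [hc, PiLp.add_apply, PiLp.smul_apply, tl_add, tl_smul, cns_zero, tl_cns, smul_eq_mul, mul_zero, add_zero] at h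
    obtain ⟨ha, hb⟩ := h
    rw [smul_smul, ← add_smul] at hb
    have hb' := (smul_eq_zero.1 hb).resolve_right (sph_ne c)
    have hs := sph_eq x
    have hp : 0 ≤ (1 - t) * ‖tl (x : Eu (m + 2))‖ := mul_nonneg (by linarith) (norm_nonneg _)
    have ht : t = 0 := by linarith
    subst ht
    have h4 : ‖tl (x : Eu (m + 2))‖ = 0 := by linarith
    have h5 : (x : Eu (m + 2)) 0 = 0 := by linarith
    rw [h4, h5] at hs
    norm_num at hs

end susp
end TCS

namespace TCS
section genpos
variable {m : ℕ}

noncomputable def sgv (y : Eu m) : Eu (m + 1) := (‖y‖ ^ 2 + 1)⁻¹ • cns (‖y‖ ^ 2 - 1) ((2 : ℝ) • y)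

theorem sgv_mem (y : Eu m) : sgv y ∈ Metric.sphere (0 : Eu (m + 1)) 1 := by
  rw [mem_sphere_zero_iff_norm, ← sq_eq_sq₀ (norm_nonneg _) zero_le_one, norm_sq_cns]
  have h : (0 : ℝ) < ‖y‖ ^ 2 + 1 := by positivity
  simp only [sgv, PiLp.smul_apply, cns_zero, tl_smul, tl_cns, norm_smul, smul_eq_mul]
  rw [Real.norm_eq_abs, Real.norm_eq_abs, abs_of_pos (inv_pos.2 h), abs_of_pos (two_pos)]
  field_simp
  ring

noncomputable def sgs (y : Eu m) : Sph m := ⟨sgv y, sgv_mem y⟩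

noncomputable def pole (m : ℕ) : Sph m := ptS m

theorem sgs_inv (x : Sph m) (hx : x ≠ pole m) :
    (x : Eu (m + 1)) 0 ≠ 1 ∧ sgs ((1 - (x : Eu (m + 1)) 0)⁻¹ • tl (x : Eu (m + 1))) = x := by
  have hs := sph_eq x
  have h1 : (x : Eu (m + 1)) 0 ≠ 1 := by
    intro h
    apply hx
    apply Subtype.ext
    rw [h] at hs
    have h2 : tl (x : Eu (m + 1)) = 0 := by
      rw [← norm_eq_zero]
      nlinarith [norm_nonneg (tl (x : Eu (m + 1)))]
    rw [← cns_tl (x : Eu (m + 1)), h, h2]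
    ext i
    refine Fin.cases ?_ (fun i => ?_) i
    · simp [pole, ptS]
    · simp [pole, ptS]
  refine ⟨h1, Subtype.ext ?_⟩
  have h2 : (1 - (x : Eu (m + 1)) 0) ≠ 0 := sub_ne_zero.2 (Ne.symm h1)
  set a := (x : Eu (m + 1)) 0 with ha
  have h3 : ‖(1 - a)⁻¹ • tl (x : Eu (m + 1))‖ ^ 2 = (1 + a) / (1 - a) := by
    rw [norm_smul, mul_pow, Real.norm_eq_abs, sq_abs]
    have : ‖tl (x : Eu (m + 1))‖ ^ 2 = (1 - a) * (1 + a) := by linarith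
    rw [this]; field_simp
  have h4 : ((1 + a) / (1 - a) + 1)⁻¹ = (1 - a) / 2 := by
    have : (1 + a) / (1 - a) + 1 = 2 / (1 - a) := by field_simp; ring
    rw [this, inv_div]
  change sgv _ = _
  unfold sgv
  rw [h3, h4]
  ext i
  refine Fin.cases ?_ (fun i => ?_) i
  · simp only [PiLp.smul_apply, cns_zero, smul_eq_mul]
    rw [← ha]; field_simp; ring
  · simp only [PiLp.smul_apply, cns_succ, smul_eq_mul, tl_apply]
    field_simp

def smoothAlg (m : ℕ) : Subalgebra ℝ C(Sph m, ℝ) where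
  carrier := {g | Differentiable ℝ (fun y => g (sgs y))}
  mul_mem' ha hb := by
    simp only [mem_ofPred_eq, ContinuousMap.mul_apply] at *
    exact ha.mul hb
  add_mem' ha hb := by
    simp only [mem_ofPred_eq, ContinuousMap.add_apply] at *
    exact ha.add hb
  algebraMap_mem' r := by
    simp only [mem_ofPred_eq]
    exact differentiable_const r

theorem coord_smooth (i : Fin (m + 1)) :
    (⟨fun x : Sph m => (x : Eu (m + 1)) i, by fun_prop⟩ : C(Sph m, ℝ)) ∈ smoothAlg m := by
  change Differentiable ℝ (fun y => sgv y i)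
  have h0 : ∀ y : Eu m, ‖y‖ ^ 2 + 1 ≠ 0 := fun y => by positivity
  have h1 : Differentiable ℝ (fun y : Eu m => (‖y‖ ^ 2 + 1)⁻¹) :=
    ((differentiable_id.norm_sq ℝ).add_const 1).inv h0
  refine Fin.cases ?_ (fun i => ?_) i
  · simp only [sgv, PiLp.smul_apply, cns_zero, smul_eq_mul]
    exact h1.mul ((differentiable_id.norm_sq ℝ).sub_const 1)
  · simp only [sgv, PiLp.smul_apply, cns_succ, smul_eq_mul]
    refine h1.mul (Differentiable.const_mul ?_ _)
    fun_prop

theorem smooth_approx (f : C(Sph m, ℝ)) (ε : ℝ) (hε : 0 < ε) :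
    ∃ g : C(Sph m, ℝ), Differentiable ℝ (fun y => g (sgs y)) ∧ ∀ x, |g x - f x| < ε := by
  obtain ⟨g, hg⟩ := ContinuousMap.exists_mem_subalgebra_near_continuous_of_separatesPoints (smoothAlg m) (by
    intro x y hxy
    have : ∃ i, (x : Eu (m + 1)) i ≠ (y : Eu (m + 1)) i := by
      by_contra h
      push Not at h
      exact hxy (Subtype.ext (by ext i; exact h i))
    obtain ⟨i, hi⟩ := this
    exact ⟨_, ⟨_, coord_smooth i, rfl⟩, hi⟩) f f.continuous ε hε
  exact ⟨g.1, g.2, fun x => by simpa using hg x⟩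

theorem norm_lt_of_coord (v : Eu (m + 1)) (h : ∀ i, |v i| < 1 / (2 * ((m : ℝ) + 1))) : ‖v‖ < 1 / 2 := by
  have h1 : ‖v‖ ≤ ∑ i, |v i| := by
    have : v = ∑ i, v i • EuclideanSpace.single i (1 : ℝ) := by
      ext j; simp [Finset.sum_apply, Pi.single_apply]
    calc ‖v‖ = ‖∑ i, v i • EuclideanSpace.single i (1 : ℝ)‖ := by rw [← this]
      _ ≤ ∑ i, ‖v i • (EuclideanSpace.single i (1 : ℝ) : Eu (m + 1))‖ := norm_sum_le _ _
      _ = ∑ i, |v i| := by simp [norm_smul]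
  have h2 : ∑ i, |v i| < ∑ i : Fin (m + 1), 1 / (2 * ((m : ℝ) + 1)) :=
    Finset.sum_lt_sum_of_nonempty (by simp) (fun i _ => h i)
  have h3 : ∑ i : Fin (m + 1), 1 / (2 * ((m : ℝ) + 1)) = 1 / 2 := by
    simp
    field_simp
  linarith

theorem genpos (f : C(Sph (m + 1), Sph (m + 1))) : ∃ F : C(Sph (m + 1), Eu (m + 2)),
    ∃ hne : ∀ x, F x ≠ 0, f.Homotopic (mkS F F.continuous hne) ∧ {x | tl (F x) = 0}.Finite := by
  have h1 : ∀ i : Fin (m + 2), ∃ g : C(Sph (m + 1), ℝ), Differentiable ℝ (fun y => g (sgs y)) ∧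
      ∀ x, |g x - (f x : Eu (m + 2)) i| < 1 / (2 * (((m + 1 : ℕ) : ℝ) + 1)) := fun i =>
    smooth_approx ⟨fun x => (f x : Eu (m + 2)) i, by fun_prop⟩ _ (by positivity)
  choose g hg hgf using h1
  let P : Sph (m + 1) → Eu (m + 2) := fun x => WithLp.toLp 2 (fun i => g i x)
  have hP : Continuous P := (PiLp.continuous_toLp 2 _).comp (continuous_pi fun i => (g i).continuous)
  have hPf : ∀ x, ‖P x - f x‖ < 1 / 2 := fun x => norm_lt_of_coord _ (fun i => hgf i x)
  let Q : Eu (m + 1) → Eu (m + 1) := fun y => tl (P (sgs y))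
  have hQ : Differentiable ℝ Q := by
    rw [differentiable_euclidean]
    intro i
    exact hg i.succ
  have hnull : MeasureTheory.volume (Q '' {y | (fderiv ℝ Q y).det = 0} ∪ {tl (P (pole (m + 1)))}) = 0 := by
    rw [MeasureTheory.measure_union_null_iff]
    refine ⟨?_, by simp⟩
    exact MeasureTheory.addHaar_image_eq_zero_of_det_fderivWithin_eq_zero _
      (fun x _ => (hQ x).hasFDerivAt.hasFDerivWithinAt) (fun x hx => hx)
  obtain ⟨w, hw, hw'⟩ : ∃ w : Eu (m + 1), ‖w‖ < 1 / 4 ∧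
      w ∉ Q '' {y | (fderiv ℝ Q y).det = 0} ∪ {tl (P (pole (m + 1)))} := by
    by_contra hcon
    push Not at hcon
    have : Metric.ball (0 : Eu (m + 1)) (1 / 4) ⊆ Q '' {y | (fderiv ℝ Q y).det = 0} ∪ {tl (P (pole (m + 1)))} := by
      intro w hw
      exact hcon w (by simpa using hw)
    have h2 := MeasureTheory.measure_mono_null this hnull
    exact (Metric.measure_ball_pos MeasureTheory.volume (0 : Eu (m + 1)) (by norm_num : (0:ℝ) < 1 / 4)).ne' h2
  simp only [mem_union, mem_image, mem_ofPred_eq, mem_singleton_iff, not_or, not_exists, not_and] at hw'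
  obtain ⟨hw1, hw2⟩ := hw'
  let F : C(Sph (m + 1), Eu (m + 2)) := ⟨fun x => P x - cns 0 w, by fun_prop⟩
  have hFf : ∀ x, ‖(f x : Eu (m + 2)) - F x‖ < 1 := by
    intro x
    have e : (f x : Eu (m + 2)) - F x = cns 0 w - (P x - f x) := by
      change (f x : Eu (m + 2)) - (P x - cns 0 w) = _
      abel
    have hn : ‖(cns 0 w : Eu (m + 2))‖ = ‖w‖ := by
      rw [← sq_eq_sq₀ (norm_nonneg _) (norm_nonneg _), norm_sq_cns]; simp
    rw [e]
    refine (norm_sub_le _ _).trans_lt ?_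
    rw [hn]
    linarith [hPf x]
  have hne : ∀ x, F x ≠ 0 := by
    intro x h
    have := hFf x
    rw [h, sub_zero, sph_norm] at this
    exact lt_irrefl _ this
  refine ⟨F, hne, hom_near _ _ F F.continuous (fun x => mkS_pos F F.continuous hne x) hFf, ?_⟩
  have hZ : ∀ x, tl (F x) = 0 ↔ tl (P x) = w := by
    intro x
    change tl (P x - cns 0 w) = 0 ↔ _
    rw [tl_sub, tl_cns, sub_eq_zero]
  by_contra hinf
  have hcl : IsClosed {x | tl (F x) = 0} := isClosed_eq (by fun_prop) continuous_const
  obtain ⟨x₀, hx₀, hacc⟩ := Set.Infinite.exists_accPt_of_subset_isCompact hinf hcl.isCompact subset_rfl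
  have hx₀' := (hZ x₀).1 hx₀
  have hxp : ∀ x : Sph (m + 1), tl (P x) = w → x ≠ pole (m + 1) := by
    rintro x hx rfl
    exact hw2 hx.symm
  let τ : Sph (m + 1) → Eu (m + 1) := fun x => (1 - (x : Eu (m + 2)) 0)⁻¹ • tl (x : Eu (m + 2))
  have hστ : ∀ x, x ≠ pole (m + 1) → sgs (τ x) = x := fun x hx => (sgs_inv x hx).2
  have hτc : ContinuousAt τ x₀ := by
    have : Continuous fun x : Sph (m + 1) => 1 - (x : Eu (m + 2)) 0 := by fun_prop
    have h3 : Continuous fun x : Sph (m + 1) => tl (x : Eu (m + 2)) := by fun_prop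
    exact (this.continuousAt.inv₀ (sub_ne_zero.2 (Ne.symm (sgs_inv x₀ (hxp _ hx₀')).1))).smul h3.continuousAt
  have hdet : (fderiv ℝ Q (τ x₀)).det ≠ 0 := by
    intro h
    apply hw1 _ h
    simp only [Q]
    rw [hστ _ (hxp _ hx₀'), hx₀']
  have hev : ∀ᶠ y in nhdsWithin (τ x₀) {τ x₀}ᶜ, Q y ≠ w := by
    apply (hQ (τ x₀)).hasFDerivAt.eventually_ne
    let e := (fderiv ℝ Q (τ x₀)).toContinuousLinearEquivOfDetNeZero hdet
    exact ⟨_, e.antilipschitz⟩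
  rw [eventually_nhdsWithin_iff] at hev
  have hev2 := hτc.eventually hev
  rw [accPt_iff_frequently] at hacc
  refine hacc ?_
  filter_upwards [hev2] with x hx hx'
  obtain ⟨hx1, hx2⟩ := hx'
  have hx3 := (hZ x).1 hx2
  apply hx
  · intro h
    apply hx1
    rw [← hστ x (hxp x hx3), ← hστ x₀ (hxp x₀ hx₀'), h]
  · simp only [Q]
    rw [hστ x (hxp x hx3), hx3]

end genpos
end TCS

namespace TCS
section frame
variable {k : ℕ}

theorem avoid {E : Type*} [AddCommGroup E] [Module ℝ E] {ι : Type*} [Finite ι] (p : ι → Submodule ℝ E)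
    (hp : ∀ i, p i ≠ ⊤) : ∃ v, ∀ i, v ∉ p i := by
  by_contra h
  push Not at h
  obtain ⟨i, hi⟩ := Subspace.exists_eq_top_of_iUnion_eq_univ (p := p) (by
    rw [eq_univ_iff_forall]
    intro v
    obtain ⟨i, hi⟩ := h v
    exact mem_iUnion.2 ⟨i, hi⟩)
  exact hp i hi

theorem span1 {E : Type*} [AddCommGroup E] [Module ℝ E] (v : E) :
    Module.finrank ℝ (Submodule.span ℝ {v}) ≤ 1 := by
  have := finrank_span_le_card (R := ℝ) ({v} : Set E)
  simpa using this

theorem frame (Z : Set (Eu (k + 3))) (hZ : Z.Finite) (hne : ∀ z ∈ Z, z ≠ 0) :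
    ∃ b : OrthonormalBasis (Fin (k + 3)) ℝ (Eu (k + 3)), (∀ z ∈ Z, inner ℝ (b 0) z ≠ 0) ∧
      ∀ z ∈ Z, ∀ z' ∈ Z, z ≠ z' → inner ℝ (b 2) z ≠ inner ℝ (b 2) z' := by
  classical
  have : Finite Z := hZ
  have hspan : ∀ v : Eu (k + 3), (Submodule.span ℝ {v}) ≠ ⊤ := by
    intro v h
    have h1 := span1 v
    rw [h, finrank_top, finrank_euclideanSpace_fin] at h1
    omega
  obtain ⟨q', hq'⟩ := avoid (ι := Z ⊕ (Z × Z) ⊕ Unit) (fun i => match i with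
    | Sum.inl z => (Submodule.span ℝ {(z : Eu (k + 3))})ᗮ
    | Sum.inr (Sum.inl z) => Submodule.span ℝ {(z.1 : Eu (k + 3)) - z.2}
    | Sum.inr (Sum.inr _) => Submodule.span ℝ {(0 : Eu (k + 3))}) (by
      rintro (z | z | z)
      · intro h
        simp only at h
        rw [Submodule.orthogonal_eq_top_iff, Submodule.span_singleton_eq_bot] at h
        exact hne z z.2 h
      · exact hspan _
      · exact hspan _)
  have hq0 : q' ≠ 0 := fun h => hq' (Sum.inr (Sum.inr ())) (by rw [h]; exact Submodule.zero_mem _)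
  have hqz : ∀ z ∈ Z, inner ℝ q' z ≠ 0 := by
    intro z hz h
    apply hq' (Sum.inl ⟨z, hz⟩)
    exact Submodule.mem_orthogonal_singleton_iff_inner_left.2 h
  have hqs : ∀ z ∈ Z, ∀ z' ∈ Z, q' ∉ Submodule.span ℝ {z - z'} := fun z hz z' hz' =>
    hq' (Sum.inr (Sum.inl (⟨z, hz⟩, ⟨z', hz'⟩)))
  let W := (Submodule.span ℝ {q'})ᗮ
  have hWbot : (⊥ : Submodule ℝ W) ≠ ⊤ := by
    intro h
    have h2 : Module.finrank ℝ W = 0 := by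
      rw [← finrank_top ℝ W, ← h, finrank_bot]
    have h3 := Submodule.finrank_add_finrank_orthogonal (Submodule.span ℝ {q'})
    have h1 := span1 q'
    rw [finrank_euclideanSpace_fin] at h3
    change _ + Module.finrank ℝ W = _ at h3
    omega
  obtain ⟨r', hr'⟩ := avoid (E := W) (ι := (Z × Z) ⊕ Unit) (fun i => match i with
    | Sum.inl z => if z.1 = z.2 then ⊥ else (Submodule.span ℝ {(z.1 : Eu (k + 3)) - z.2})ᗮ.comap W.subtype
    | Sum.inr _ => ⊥) (by
      rintro (z | z)
      · simp only
        split_ifs with hz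
        · exact hWbot
        · intro h
          rw [Submodule.comap_subtype_eq_top] at h
          have h2 := Submodule.orthogonal_le h
          rw [Submodule.orthogonal_orthogonal, Submodule.orthogonal_orthogonal] at h2
          have h3 := h2 (Submodule.mem_span_singleton_self _)
          rw [Submodule.mem_span_singleton] at h3
          obtain ⟨c, hc⟩ := h3
          apply hqs z.1 z.1.2 z.2 z.2.2
          rw [Submodule.mem_span_singleton]
          have hc0 : c ≠ 0 := by
            rintro rfl
            rw [zero_smul] at hc
            exact hz (Subtype.ext (sub_eq_zero.1 hc.symm))
          exact ⟨c⁻¹, by rw [← hc, smul_smul, inv_mul_cancel₀ hc0, one_smul]⟩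
      · exact hWbot)
  have hr0 : (r' : Eu (k + 3)) ≠ 0 := fun h => hr' (Sum.inr ()) (by
    simp only [Submodule.mem_bot]; exact Subtype.ext h)
  have hrz : ∀ z ∈ Z, ∀ z' ∈ Z, z ≠ z' → inner ℝ (r' : Eu (k + 3)) (z - z') ≠ 0 := by
    intro z hz z' hz' hzz h
    apply hr' (Sum.inl (⟨z, hz⟩, ⟨z', hz'⟩))
    have : ¬ ((⟨z, hz⟩ : Z) = ⟨z', hz'⟩) := fun h => hzz (congrArg Subtype.val h)
    simp only [this, if_false]
    exact Submodule.mem_orthogonal_singleton_iff_inner_left.2 h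
  have hqr : inner ℝ q' (r' : Eu (k + 3)) = 0 := Submodule.mem_orthogonal_singleton_iff_inner_right.1 r'.2
  let v : Fin (k + 3) → Eu (k + 3) := fun i => if i = 0 then ‖q'‖⁻¹ • q' else ‖(r' : Eu (k + 3))‖⁻¹ • (r' : Eu (k + 3))
  have h20 : (2 : Fin (k + 3)) ≠ 0 := by
    intro h; have := congrArg Fin.val h; simp at this; rw [Nat.mod_eq_of_lt (by omega)] at this; omega
  obtain ⟨b, hb⟩ := Orthonormal.exists_orthonormalBasis_extension_of_card_eq (𝕜 := ℝ) (E := Eu (k + 3)) (ι := Fin (k + 3))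
    (by simp) (v := v) (s := {0, 2}) (by
      constructor
      · rintro ⟨i, hi⟩
        simp only [Set.domRestrict_apply, v]
        split_ifs
        · rw [norm_smul, norm_inv, norm_norm, inv_mul_cancel₀ (norm_ne_zero_iff.2 hq0)]
        · rw [norm_smul, norm_inv, norm_norm, inv_mul_cancel₀ (norm_ne_zero_iff.2 hr0)]
      · rintro ⟨i, hi⟩ ⟨j, hj⟩ hij
        simp only [Set.domRestrict_apply, v]
        have hij' : i ≠ j := fun h => hij (Subtype.ext h)
        simp only [mem_insert_iff, mem_singleton_iff] at hi hj
        rcases hi with rfl | rfl <;> rcases hj with rfl | rfl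
        · exact absurd rfl hij'
        · simp [h20, inner_smul_left, inner_smul_right, hqr]
        · simp [h20, inner_smul_left, inner_smul_right, real_inner_comm, hqr]
        · exact absurd rfl hij')
  have hb0 : b 0 = ‖q'‖⁻¹ • q' := by rw [hb 0 (by simp)]; simp [v]
  have hb2 : b 2 = ‖(r' : Eu (k + 3))‖⁻¹ • (r' : Eu (k + 3)) := by rw [hb 2 (by simp)]; simp [v, h20]
  refine ⟨b, fun z hz => ?_, fun z hz z' hz' hzz => ?_⟩
  · rw [hb0, inner_smul_left]
    exact mul_ne_zero (by simpa using hq0) (hqz z hz)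
  · rw [← sub_ne_zero, ← inner_sub_right, hb2, inner_smul_left]
    exact mul_ne_zero (by simpa using hr0) (hrz z hz z' hz' hzz)

end frame
end TCS

namespace TCS
section normform
variable {k : ℕ}

noncomputable def rot (θ : ℝ) (x : Eu (k + 3)) : Eu (k + 3) :=
  cns (Real.cos θ * x 0 - Real.sin θ * tl x 0) (cns (Real.sin θ * x 0 + Real.cos θ * tl x 0) (tl (tl x)))

theorem rot_norm (θ : ℝ) (x : Eu (k + 3)) : ‖rot θ x‖ = ‖x‖ := by
  rw [← sq_eq_sq₀ (norm_nonneg _) (norm_nonneg _), norm_sq_cns, norm_sq_cns (tl _), norm_sq_cns x, norm_sq_cns (tl x)]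
  simp only [rot, cns_zero, tl_cns]
  linear_combination (x 0 ^ 2 + (tl x 0) ^ 2) * Real.sin_sq_add_cos_sq θ

theorem rot_zero (x : Eu (k + 3)) : rot 0 x = x := by
  simp only [rot, Real.cos_zero, Real.sin_zero, one_mul, zero_mul, sub_zero, zero_add, cns_tl]

theorem rot_two (θ : ℝ) (x : Eu (k + 3)) : tl (tl (rot θ x)) = tl (tl x) := by
  simp [rot]

theorem rot_cont : Continuous (fun p : ℝ × Eu (k + 3) => rot p.1 p.2) := by
  unfold rot
  fun_prop

theorem rot_mem (θ : ℝ) (x : Sph (k + 2)) : rot θ (x : Eu (k + 3)) ∈ Metric.sphere (0 : Eu (k + 3)) 1 := by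
  rw [mem_sphere_zero_iff_norm, rot_norm, sph_norm]

theorem liso_mem {n : ℕ} (L : Eu (n + 1) ≃ₗᵢ[ℝ] Eu (n + 1)) (x : Sph n) :
    L (x : Eu (n + 1)) ∈ Metric.sphere (0 : Eu (n + 1)) 1 := by
  rw [mem_sphere_zero_iff_norm, LinearIsometryEquiv.norm_map, sph_norm]

noncomputable def lisoS {n : ℕ} (L : Eu (n + 1) ≃ₗᵢ[ℝ] Eu (n + 1)) : C(Sph n, Sph n) where
  toFun x := ⟨L (x : Eu (n + 1)), liso_mem L x⟩
  continuous_toFun := Continuous.subtype_mk (L.continuous.comp continuous_subtype_val) _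

theorem normform (f : C(Sph (k + 2), Sph (k + 2))) : ∃ O O' : C(Sph (k + 2), Sph (k + 2)),
    O.comp O' = ContinuousMap.id _ ∧ ∃ F : C(Sph (k + 2), Eu (k + 3)), ∃ hne : ∀ x, F x ≠ 0,
    (f.comp O).Homotopic (mkS F F.continuous hne) ∧
    ∀ x, tl (F x) = 0 → 0 < F x 0 * (x : Eu (k + 3)) 0 := by
  obtain ⟨F₁, hne₁, hhom, hfin⟩ := genpos f
  let Z : Set (Eu (k + 3)) := Subtype.val '' {x | tl (F₁ x) = 0}
  obtain ⟨b, hb0, hb2⟩ := frame Z (hfin.image _) (by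
    rintro _ ⟨z, _, rfl⟩; exact sph_ne z)
  let O : C(Sph (k + 2), Sph (k + 2)) := lisoS b.repr.symm
  let O' : C(Sph (k + 2), Sph (k + 2)) := lisoS b.repr
  have hOO : O.comp O' = ContinuousMap.id _ := by
    ext1 x
    apply Subtype.ext
    simp [O, O', lisoS]
  have hOc : ∀ (y : Sph (k + 2)) i, inner ℝ (b i) (O y : Eu (k + 3)) = (y : Eu (k + 3)) i := by
    intro y i
    rw [← b.repr_apply_apply]
    simp [O, lisoS]
  let A : Set ℝ := (fun z : Sph (k + 2) => inner ℝ (b 2) (z : Eu (k + 3))) '' {z | tl (F₁ z) = 0 ∧ 0 < F₁ z 0 * inner ℝ (b 0) (z : Eu (k + 3))}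
  let B : Set ℝ := (fun z : Sph (k + 2) => inner ℝ (b 2) (z : Eu (k + 3))) '' {z | tl (F₁ z) = 0 ∧ F₁ z 0 * inner ℝ (b 0) (z : Eu (k + 3)) < 0}
  have hA : IsClosed A := ((hfin.subset (fun z hz => hz.1)).image _).isClosed
  have hB : IsClosed B := ((hfin.subset (fun z hz => hz.1)).image _).isClosed
  have hAB : Disjoint A B := by
    rw [Set.disjoint_left]
    rintro _ ⟨z, hz, rfl⟩ ⟨z', hz', h⟩
    by_cases hzz : (z : Eu (k + 3)) = z'
    · have : z = z' := Subtype.ext hzz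
      subst this
      linarith [hz.2, hz'.2]
    · exact hb2 z ⟨z, hz.1, rfl⟩ z' ⟨z', hz'.1, rfl⟩ hzz h.symm
  obtain ⟨ρ, hρA, hρB, -⟩ := exists_continuous_zero_one_of_isClosed hA hB hAB
  let Ψ : C(unitInterval × Sph (k + 2), Sph (k + 2)) :=
    ⟨fun p => ⟨rot ((p.1 : ℝ) * (Real.pi * ρ (tl (tl (p.2 : Eu (k + 3))) 0))) (p.2 : Eu (k + 3)), rot_mem _ _⟩,
      Continuous.subtype_mk (rot_cont.comp (Continuous.prodMk (by fun_prop) (by fun_prop))) _⟩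
  let ψ : C(Sph (k + 2), Sph (k + 2)) := Ψ.comp ⟨fun x => (1, x), by fun_prop⟩
  have hψ : (ContinuousMap.id _).Homotopic ψ := by
    refine ⟨⟨Ψ, ?_, ?_⟩⟩
    · intro x
      apply Subtype.ext
      simp [Ψ, rot_zero]
    · intro x; rfl
  have hψc : ∀ x, (ψ x : Eu (k + 3)) = rot (Real.pi * ρ (tl (tl (x : Eu (k + 3))) 0)) (x : Eu (k + 3)) := by
    intro x; simp [ψ, Ψ]
  let F := F₁.comp (O.comp ψ)
  have hne : ∀ x, F x ≠ 0 := fun x => hne₁ _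
  refine ⟨O, O', hOO, F, hne, ?_, ?_⟩
  · have e : mkS F F.continuous hne = (mkS F₁ F₁.continuous hne₁).comp (O.comp ψ) := rfl
    rw [e]
    refine (hhom.comp (.refl O)).trans ?_
    have h2 : (O.comp (ContinuousMap.id _)).Homotopic (O.comp ψ) := (ContinuousMap.Homotopic.refl O).comp hψ
    exact (ContinuousMap.Homotopic.refl (mkS F₁ F₁.continuous hne₁)).comp h2
  · intro x hx
    set y := ψ x with hy
    set z := O y with hz
    have hx' : tl (F₁ z) = 0 := hx
    change 0 < F₁ z 0 * _
    have hy2 : (y : Eu (k + 3)) 2 = tl (tl (x : Eu (k + 3))) 0 := by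
      rw [← rot_two (Real.pi * ρ (tl (tl (x : Eu (k + 3))) 0)) (x : Eu (k + 3)), ← hψc]
      rfl
    have hF0 : F₁ z 0 ≠ 0 := fun h => hne₁ z ((eq_zero_iff _).2 ⟨h, hx'⟩)
    have hz0 := hb0 z ⟨z, hx', rfl⟩
    have hprod : F₁ z 0 * inner ℝ (b 0) (z : Eu (k + 3)) ≠ 0 := mul_ne_zero hF0 hz0
    have hyc := hψc x
    rw [← hy] at hyc
    have hb2z : inner ℝ (b 2) (z : Eu (k + 3)) = tl (tl (x : Eu (k + 3))) 0 := by
      rw [hOc, hy2]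
    have hb0z : inner ℝ (b 0) (z : Eu (k + 3)) = (y : Eu (k + 3)) 0 := hOc _ _
    rcases lt_or_gt_of_ne hprod with h | h
    · have h1 : ρ (tl (tl (x : Eu (k + 3))) 0) = 1 := by
        rw [← hb2z]; exact hρB ⟨z, ⟨hx', h⟩, rfl⟩
      rw [h1, mul_one] at hyc
      have : (y : Eu (k + 3)) 0 = - (x : Eu (k + 3)) 0 := by
        rw [hyc]; simp [rot]
      rw [hb0z, this] at h
      linarith
    · have h1 : ρ (tl (tl (x : Eu (k + 3))) 0) = 0 := by
        rw [← hb2z]; exact hρA ⟨z, ⟨hx', h⟩, rfl⟩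
      rw [h1, mul_zero, rot_zero] at hyc
      rw [hb0z, hyc] at h
      exact h

theorem eq_mem {m : ℕ} (v : Sph m) : cns 0 (v : Eu (m + 1)) ∈ Metric.sphere (0 : Eu (m + 2)) 1 := by
  rw [mem_sphere_zero_iff_norm, ← sq_eq_sq₀ (norm_nonneg _) zero_le_one, norm_sq_cns]
  simp

theorem desusp (f : C(Sph (k + 2), Sph (k + 2))) (hf : ¬ f.Nullhomotopic) :
    ∃ (O : C(Sph (k + 2), Sph (k + 2))) (g : C(Sph (k + 1), Sph (k + 1))), ¬ g.Nullhomotopic ∧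
      (f.comp O).Homotopic (susp g) := by
  obtain ⟨O, O', hOO, F, hne, hhom, hF⟩ := normform f
  let G : Sph (k + 1) → Eu (k + 2) := fun v => tl (F ⟨cns 0 (v : Eu (k + 2)), eq_mem v⟩)
  have hG : Continuous G := by
    have : Continuous (fun v : Sph (k + 1) => (⟨cns 0 (v : Eu (k + 2)), eq_mem v⟩ : Sph (k + 2))) :=
      Continuous.subtype_mk (by fun_prop) _
    exact tl_cont.comp (F.continuous.comp this)
  have hGne : ∀ v, G v ≠ 0 := by
    intro v h
    have := hF _ h
    simp at this
  let g := mkS G hG hGne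
  have h1 : (mkS F F.continuous hne).Homotopic (mkS (fun x : Sph (k + 2) => cns ((x : Eu (k + 3)) 0) (tl (F x))) (by fun_prop) (by
      intro x h
      rw [eq_zero_iff] at h
      simp only [cns_zero, tl_cns] at h
      have := hF x h.2
      rw [h.1] at this
      simp at this)) := by
    refine hom_line _ _ F (fun x : Sph (k + 2) => cns ((x : Eu (k + 3)) 0) (tl (F x))) F.continuous (by fun_prop) ?_
      (fun x => mkS_pos _ _ _ x) (fun x => mkS_pos (fun x : Sph (k + 2) => cns ((x : Eu (k + 3)) 0) (tl (F x))) _ _ x)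
    intro t ht0 ht1 x h
    rw [eq_zero_iff] at h
    simp only [PiLp.add_apply, PiLp.smul_apply, tl_add, tl_smul, cns_zero, tl_cns, smul_eq_mul] at h
    obtain ⟨ha, hb⟩ := h
    rw [← add_smul] at hb
    have hb' : tl (F x) = 0 := by simpa using hb
    have h3 := hF x hb'
    have h4 : ((1 - t) * F x 0 + t * (x : Eu (k + 3)) 0) * F x 0 = 0 := by rw [ha]; ring
    have h5 : (1 - t) * (F x 0 * F x 0) + t * (F x 0 * (x : Eu (k + 3)) 0) = 0 := by linarith
    have h6 : 0 < F x 0 * F x 0 := by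
      rcases eq_or_ne (F x 0) 0 with h | h
      · rw [h] at h3; simp at h3
      · exact mul_self_pos.2 h
    rcases ht1.eq_or_lt with rfl | ht
    · linarith
    · have := mul_pos (sub_pos.2 ht) h6
      have := mul_nonneg ht0 h3.le
      linarith
  have h2 := h1.trans (hom_line (mkS (fun x : Sph (k + 2) => cns ((x : Eu (k + 3)) 0) (tl (F x))) _ _) (susp g)
    (fun x : Sph (k + 2) => cns ((x : Eu (k + 3)) 0) (tl (F x))) (fun x : Sph (k + 2) => (susp g x : Eu (k + 3))) (by fun_prop) (continuous_subtype_val.comp (susp g).continuous) (by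
      intro t ht0 ht1 x h
      rw [eq_zero_iff] at h
      simp only [PiLp.add_apply, PiLp.smul_apply, tl_add, tl_smul, cns_zero, tl_cns, smul_eq_mul, susp_coe] at h
      obtain ⟨ha, hb⟩ := h
      have hx0 : (x : Eu (k + 3)) 0 = 0 := by linarith
      have hn : ‖tl (x : Eu (k + 3))‖ = 1 := by
        have := sph_eq x
        rw [hx0] at this
        have h7 : ‖tl (x : Eu (k + 3))‖ ^ 2 = 1 := by linarith
        nlinarith [norm_nonneg (tl (x : Eu (k + 3)))]
      let v : Sph (k + 1) := ⟨tl (x : Eu (k + 3)), by rw [mem_sphere_zero_iff_norm, hn]⟩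
      have hxv : x = ⟨cns 0 (v : Eu (k + 2)), eq_mem v⟩ := by
        apply Subtype.ext
        simp only [v]
        rw [← hx0, cns_tl]
      have e1 : ext1 g (tl (x : Eu (k + 3))) = g v := by
        have := ext1_smul g 1 zero_le_one v
        simpa using this
      obtain ⟨c, hc, e2⟩ := mkS_pos G hG hGne v
      have e3 : tl (F x) = c • (g v : Eu (k + 2)) := by
        rw [← e2, hxv]
      rw [e1, e3, smul_smul, ← add_smul] at hb
      have hb' := (smul_eq_zero.1 hb).resolve_right (sph_ne _)
      rcases ht0.eq_or_lt with rfl | ht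
      · linarith
      · have := mul_nonneg (sub_nonneg.2 ht1) hc.le
        linarith) (fun x => mkS_pos (fun x : Sph (k + 2) => cns ((x : Eu (k + 3)) 0) (tl (F x))) _ _ x)
      (fun x => ⟨1, one_pos, by simp⟩))
  refine ⟨O, g, ?_, hhom.trans h2⟩
  intro hg
  apply hf
  obtain ⟨y, hy⟩ := nullhom_of (hhom.trans h2) (susp_null g hg)
  refine ⟨y, ?_⟩
  have h3 := hy.comp (ContinuousMap.Homotopic.refl O')
  rw [ContinuousMap.comp_assoc, hOO, ContinuousMap.comp_id] at h3
  exact h3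

end normform
end TCS

namespace TCS
section cone

theorem aa_succ {V : Type*} (m : ℕ) (u : ℕ → V → ℤ) (x : ℕ → V) :
    aa (m + 1) u x = (u 0 (x 1) - u 0 (x 0)) * aa m (fun i => u (i + 1)) (sh 1 x) := by
  simp only [aa, bb, sh, Finset.prod_range_succ' _ m]
  simp only [fun i => add_comm 1 i]
  ring

theorem cone {m N : ℕ} [NeZero N] (hm : 1 ≤ m) (u : ℕ → (Fin (m + 1) → ZMod N) → ℤ)
    (w : ℕ → (Fin m → ZMod N) → ℤ) (a : ZMod N → ℤ) (P : ZMod N → Prop) [DecidablePred P]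
    (e : ℕ → ZMod N → ℤ)
    (h0 : ∀ z, u 0 z = a (z 0))
    (h1 : ∀ i z, u (i + 1) z = if P (z 0) then w i (fun c => z c.succ) else e i (z 0)) :
    EE (aa (m + 1) u) = (∑ s : ZMod N, (a (s + 1) - a s) * (if P (s + 1) then 1 else 0)) * EE (aa m w) := by
  have key : ∀ (s : ZMod N) (g : Fin m → ZMod N) (σ : Equiv.Perm (Fin m)),
      aa (m + 1) u (pth (Fin.cons s g : Fin (m + 1) → ZMod N) (Equiv.Perm.decomposeFin.symm (0, σ))) =
      (a (s + 1) - a s) * (if P (s + 1) then 1 else 0) * aa m w (pth g σ) := by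
    intro s g σ
    set τ := Equiv.Perm.decomposeFin.symm (0, σ) with hτ
    have t0 : τ.symm 0 = 0 := by
      rw [Equiv.symm_apply_eq]; simp [hτ]
    have t1 : ∀ c : Fin m, τ.symm c.succ = (σ.symm c).succ := by
      intro c
      rw [Equiv.symm_apply_eq]; simp [hτ]
    have p0 : ∀ j, pth (Fin.cons s g : Fin (m + 1) → ZMod N) τ (j + 1) 0 = s + 1 := by
      intro j; simp [pth, t0]
    have p00 : pth (Fin.cons s g : Fin (m + 1) → ZMod N) τ 0 0 = s := by
      simp [pth]
    have p1 : ∀ j, (fun c : Fin m => pth (Fin.cons s g : Fin (m + 1) → ZMod N) τ (j + 1) c.succ) = pth g σ j := by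
      intro j; funext c; simp [pth, t1]
    rw [aa_succ, h0, h0, p00, p0 0]
    rw [mul_assoc]
    congr 1
    simp only [aa, bb, sh, fun i => add_comm 1 i, h1, p0, p1]
    split_ifs with hP
    · simp
    · obtain ⟨m, rfl⟩ : ∃ m', m = m' + 1 := ⟨m - 1, by omega⟩
      simp
  have key2 : ∀ (s : ZMod N) (g : Fin m → ZMod N) (p : Fin (m + 1)) (σ : Equiv.Perm (Fin m)), p ≠ 0 →
      aa (m + 1) u (pth (Fin.cons s g : Fin (m + 1) → ZMod N) (Equiv.Perm.decomposeFin.symm (p, σ))) = 0 := by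
    intro s g p σ hp
    rw [aa_succ, h0, h0, pth_step _ _ 0 0, sub_self, zero_mul]
    intro h
    have h2 : (Equiv.Perm.decomposeFin.symm (p, σ)).symm 0 = 0 := Fin.ext h
    rw [Equiv.symm_apply_eq] at h2
    simp at h2
    exact hp h2.symm
  unfold EE
  rw [← Equiv.sum_comp (Fin.consEquiv (fun _ : Fin (m + 1) => ZMod N)), Fintype.sum_prod_type, Finset.sum_mul]
  refine Finset.sum_congr rfl fun s _ => ?_
  rw [Finset.mul_sum]
  refine Finset.sum_congr rfl fun g _ => ?_
  have ec : Fin.consEquiv (fun _ : Fin (m + 1) => ZMod N) (s, g) = Fin.cons s g := rfl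
  rw [← Equiv.sum_comp Equiv.Perm.decomposeFin.symm, Fintype.sum_prod_type, Finset.mul_sum,
    Finset.sum_eq_single 0]
  · refine Finset.sum_congr rfl fun σ _ => ?_
    have := key s g σ
    rw [ec, this, Equiv.Perm.decomposeFin.symm_sign]
    simp only [if_true, one_mul]
    ring
  · intro p _ hp
    refine Finset.sum_eq_zero fun σ _ => ?_
    rw [ec, key2 s g p σ hp, mul_zero]
  · simp

open Real in
noncomputable def cf (N j : ℕ) : ℤ := if 0 < cos (2 * π * (j / N)) then 1 else 0
open Real in
noncomputable def sf (N j : ℕ) : ℤ := if 0 < sin (2 * π * (j / N)) then 1 else 0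
noncomputable def hf (N j : ℕ) : ℤ := (cf N (j + 1) - cf N j) * sf N (j + 1)

theorem cf_per (N j : ℕ) (hN : 0 < N) : cf N (N + j) = cf N j := by
  have : 2 * Real.pi * (((N + j : ℕ) : ℝ) / N) = 2 * Real.pi * (j / N) + 2 * Real.pi := by
    have : (N : ℝ) ≠ 0 := by positivity
    push_cast; field_simp; ring
  rw [cf, this, Real.cos_add_two_pi, ← cf]

theorem sf_per (N j : ℕ) (hN : 0 < N) : sf N (N + j) = sf N j := by
  have : 2 * Real.pi * (((N + j : ℕ) : ℝ) / N) = 2 * Real.pi * (j / N) + 2 * Real.pi := by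
    have : (N : ℝ) ≠ 0 := by positivity
    push_cast; field_simp; ring
  rw [sf, this, Real.sin_add_two_pi, ← sf]

theorem hf_per (N j : ℕ) (hN : 0 < N) : hf N (N + j) = hf N j := by
  simp only [hf, add_assoc, cf_per _ _ hN, sf_per _ _ hN]

theorem hf_per' (N d j : ℕ) (hN : 0 < N) : hf N (d * N + j) = hf N j := by
  induction d with
  | zero => simp
  | succ d ih => rw [add_mul, one_mul, add_comm (d * N), add_assoc, hf_per _ _ hN, ih]

theorem kap (N : ℕ) (hN : 3 ≤ N) : ∑ j ∈ Finset.range N, hf N j = -1 := by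
  have hN0 : (0 : ℝ) < N := by positivity
  have hpi := Real.pi_pos
  set n := (N - 1) / 2 with hn
  have hs1 : ∀ j < n, sf N (j + 1) = 1 := by
    intro j hj
    rw [sf, if_pos]
    apply Real.sin_pos_of_pos_of_lt_pi
    · positivity
    · have : ((j + 1 : ℕ) : ℝ) / N < 1 / 2 := by
        rw [div_lt_div_iff₀ hN0 two_pos]
        have : 2 * (j + 1) < N := by omega
        have : ((2 * (j + 1) : ℕ) : ℝ) < N := by exact_mod_cast this
        push_cast at *; linarith
      nlinarith
  have hs2 : ∀ j, n ≤ j → j < N → sf N (j + 1) = 0 := by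
    intro j hj hjN
    rw [sf, if_neg]
    rw [not_lt, ← Real.sin_sub_two_pi]
    have a1 : 1 / 2 ≤ ((j + 1 : ℕ) : ℝ) / N := by
      rw [div_le_div_iff₀ two_pos hN0]
      have : N ≤ 2 * (j + 1) := by omega
      have : (N : ℝ) ≤ ((2 * (j + 1) : ℕ) : ℝ) := by exact_mod_cast this
      push_cast at *; linarith
    have a2 : ((j + 1 : ℕ) : ℝ) / N ≤ 1 := by
      rw [div_le_one hN0]; exact_mod_cast hjN
    apply Real.sin_nonpos_of_nonpos_of_neg_pi_le <;> nlinarith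
  have hc0 : cf N 0 = 1 := by simp [cf]
  have hcn : cf N n = 0 := by
    rw [cf, if_neg]
    rw [not_lt]
    have a1 : 1 / 4 ≤ (n : ℝ) / N := by
      rw [div_le_div_iff₀ (by norm_num) hN0]
      have : N ≤ 4 * n := by omega
      have : (N : ℝ) ≤ ((4 * n : ℕ) : ℝ) := by exact_mod_cast this
      push_cast at *; linarith
    have a2 : (n : ℝ) / N ≤ 1 := by
      rw [div_le_one hN0]
      have : n ≤ N := by omega
      exact_mod_cast this
    have a3 : (n : ℝ) / N ≤ 1 / 2 := by
      rw [div_le_div_iff₀ hN0 two_pos]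
      have : 2 * n ≤ N := by omega
      have : ((2 * n : ℕ) : ℝ) ≤ N := by exact_mod_cast this
      push_cast at *; linarith
    apply Real.cos_nonpos_of_pi_div_two_le_of_le <;> nlinarith
  obtain ⟨r, hr⟩ : ∃ r, N = n + r := ⟨N - n, by omega⟩
  have : ∑ j ∈ Finset.range N, hf N j = ∑ j ∈ Finset.range n, hf N j := by
    symm
    apply Finset.sum_subset
    · intro j; simp only [Finset.mem_range]; omega
    · intro j hj hj'
      simp only [Finset.mem_range] at hj hj'
      rw [hf, hs2 j (by omega) hj, mul_zero]
  rw [this, Finset.sum_congr rfl (g := fun j => cf N (j + 1) - cf N j), Finset.sum_range_sub, hcn, hc0]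
  · rfl
  · intro j hj
    rw [hf, hs1 j (Finset.mem_range.1 hj), mul_one]

theorem kap_mul (N d : ℕ) (hN : 3 ≤ N) : ∑ j ∈ Finset.range (d * N), hf N j = -d := by
  induction d with
  | zero => simp
  | succ d ih =>
    rw [add_mul, one_mul, Finset.sum_range_add, ih]
    simp only [hf_per' N d _ (by omega), kap N hN]
    push_cast; ring

theorem sum_zmod (N : ℕ) [NeZero N] (h : ℕ → ℤ) :
    ∑ s : ZMod N, h s.val = ∑ j ∈ Finset.range N, h j := by
  obtain ⟨M, rfl⟩ : ∃ M, N = M + 1 := ⟨N - 1, by have := NeZero.ne N; omega⟩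
  exact Fin.sum_univ_eq_sum_range h (M + 1)

noncomputable def cc (s : UnitAddCircle) : ℝ := (AddCircle.toCircle s : ℂ).re
noncomputable def ss (s : UnitAddCircle) : ℝ := (AddCircle.toCircle s : ℂ).im

theorem cc_cont : Continuous cc := by
  unfold cc
  exact Complex.continuous_re.comp (continuous_subtype_val.comp AddCircle.continuous_toCircle)
theorem ss_cont : Continuous ss := by
  unfold ss
  exact Complex.continuous_im.comp (continuous_subtype_val.comp AddCircle.continuous_toCircle)

theorem cc_coe (t : ℝ) : cc (t : UnitAddCircle) = Real.cos (2 * Real.pi * t) := by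
  rw [cc, AddCircle.toCircle_apply_mk, Circle.coe_exp, Complex.exp_ofReal_mul_I_re]; simp
theorem ss_coe (t : ℝ) : ss (t : UnitAddCircle) = Real.sin (2 * Real.pi * t) := by
  rw [ss, AddCircle.toCircle_apply_mk, Circle.coe_exp, Complex.exp_ofReal_mul_I_im]; simp

theorem cc_ss (s : UnitAddCircle) : cc s ^ 2 + ss s ^ 2 = 1 := by
  induction s using QuotientAddGroup.induction_on with
  | H t => 
    have h1 := cc_coe t
    have h2 := ss_coe t
    erw [h1, h2]
    linarith [Real.sin_sq_add_cos_sq (2 * Real.pi * t)]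

theorem cc_grid (N : ℕ) [NeZero N] (j : ℕ) : (if 0 < cc (ZMod.toAddCircle (j : ZMod N)) then (1 : ℤ) else 0) = cf N j := by
  rw [ZMod.toAddCircle_natCast, cc_coe]; rfl
theorem ss_grid (N : ℕ) [NeZero N] (j : ℕ) : (if 0 < ss (ZMod.toAddCircle (j : ZMod N)) then (1 : ℤ) else 0) = sf N j := by
  rw [ZMod.toAddCircle_natCast, ss_coe]; rfl

theorem kapz (N : ℕ) [NeZero N] (hN : 3 ≤ N) :
    ∑ s : ZMod N, ((if 0 < cc (ZMod.toAddCircle (s + 1)) then (1 : ℤ) else 0) - (if 0 < cc (ZMod.toAddCircle s) then (1 : ℤ) else 0)) *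
      (if 0 < ss (ZMod.toAddCircle (s + 1)) then (1 : ℤ) else 0) = -1 := by
  rw [← kap N hN, ← sum_zmod]
  refine Finset.sum_congr rfl fun s _ => ?_
  have h1 : s = ((s.val : ℕ) : ZMod N) := by simp
  have h2 : s + 1 = ((s.val + 1 : ℕ) : ZMod N) := by simp
  rw [hf, ← cc_grid, ← ss_grid, ← cc_grid, ← h1, ← h2]

end cone
end TCS

namespace TCS
section step

theorem sg_cns_zero {n : ℕ} (a : ℝ) (v : Eu n) : sg (cns a v) 0 = if 0 < a then 1 else 0 := by
  rw [sg, dif_pos (Nat.succ_pos n)]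
  exact congrArg (fun t : ℝ => if 0 < t then (1 : ℤ) else 0) (cns_zero a v)

theorem sg_cns_succ {n : ℕ} (a : ℝ) (v : Eu n) (i : ℕ) : sg (cns a v) (i + 1) = sg v i := by
  by_cases h : i < n
  · rw [sg, dif_pos (by omega), sg, dif_pos h]
    exact congrArg (fun t : ℝ => if 0 < t then (1 : ℤ) else 0) (cns_succ a v ⟨i, h⟩)
  · rw [sg, dif_neg (by omega), sg, dif_neg h]

theorem sg_smul {n : ℕ} (c : ℝ) (hc : 0 < c) (v : Eu n) (i : ℕ) : sg (c • v) i = sg v i := by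
  simp [sg, hc]

variable {m : ℕ}

noncomputable def gamE (γ : C(Tor m, Sph m)) (z : Tor (m + 1)) : Eu (m + 1) :=
  max (ss (z 0)) 0 • (γ (fun c => z c.succ) : Eu (m + 1)) + max (-ss (z 0)) 0 • (γ 0 : Eu (m + 1))

theorem gamE_pos (γ : C(Tor m, Sph m)) (z : Tor (m + 1)) (h : 0 < ss (z 0)) :
    gamE γ z = ss (z 0) • (γ (fun c => z c.succ) : Eu (m + 1)) := by
  rw [gamE, max_eq_left h.le, max_eq_right (by linarith)]; simp

theorem gamE_neg (γ : C(Tor m, Sph m)) (z : Tor (m + 1)) (h : ¬ 0 < ss (z 0)) :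
    gamE γ z = (-ss (z 0)) • (γ 0 : Eu (m + 1)) := by
  rw [gamE, max_eq_right (not_lt.1 h), max_eq_left (by linarith)]; simp

theorem gam_mem (γ : C(Tor m, Sph m)) (z : Tor (m + 1)) :
    cns (cc (z 0)) (gamE γ z) ∈ Metric.sphere (0 : Eu (m + 2)) 1 := by
  have : ‖gamE γ z‖ ^ 2 = ss (z 0) ^ 2 := by
    by_cases h : 0 < ss (z 0)
    · rw [gamE_pos γ z h, norm_smul, sph_norm]; simp
    · rw [gamE_neg γ z h, norm_smul, sph_norm]; simp
  rw [mem_sphere_zero_iff_norm, ← sq_eq_sq₀ (norm_nonneg _) zero_le_one, norm_sq_cns]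
  simp only [cns_zero, tl_cns, this]
  rw [cc_ss]; simp

noncomputable def gam (γ : C(Tor m, Sph m)) : C(Tor (m + 1), Sph (m + 1)) where
  toFun z := ⟨cns (cc (z 0)) (gamE γ z), gam_mem γ z⟩
  continuous_toFun := by
    refine Continuous.subtype_mk (cns_cont2 (cc_cont.comp (continuous_apply 0)) ?_) _
    have h1 : Continuous (fun z : Tor (m + 1) => ss (z 0)) := ss_cont.comp (continuous_apply 0)
    have h2 : Continuous (fun z : Tor (m + 1) => (γ (fun c => z c.succ) : Eu (m + 1))) := by fun_prop
    unfold gamE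
    exact ((h1.max continuous_const).smul h2).add ((h1.neg.max continuous_const).smul continuous_const)

theorem deg_gam (hm : 1 ≤ m) (γ : C(Tor m, Sph m)) (g : C(Sph m, Sph m)) (M : ℕ) (hM : 2 ≤ M) :
    deg M ((susp g).comp (gam γ)) = - deg M (g.comp γ) := by
  have := cone (N := M + 1) hm (uu ((susp g).comp (gam γ))) (uu (g.comp γ))
    (fun s => if 0 < cc (ZMod.toAddCircle s) then 1 else 0)
    (fun s => 0 < ss (ZMod.toAddCircle s))
    (fun i s => sg (ext1 g ((-ss (ZMod.toAddCircle s)) • (γ 0 : Eu (m + 1)))) i) ?_ ?_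
  · unfold deg
    rw [this, kapz (M + 1) (by omega)]; ring
  · intro z
    exact sg_cns_zero _ _
  · intro i z
    have e : uu ((susp g).comp (gam γ)) (i + 1) z = sg (ext1 g (gamE γ (grid z))) i := by
      have : (((susp g).comp (gam γ)) (grid z) : Eu (m + 2)) = cns (cc (grid z 0)) (ext1 g (gamE γ (grid z))) := by
        rw [ContinuousMap.comp_apply, susp_coe]
        simp [gam]
      rw [uu, this, sg_cns_succ]
    rw [e]
    split_ifs with h
    · have h2 : 0 < ss (grid z 0) := h
      rw [gamE_pos _ _ h2, ext1_smul _ _ h2.le, sg_smul _ h2]; rfl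
    · rw [gamE_neg _ _ h]; rfl

theorem hopf_step {k : ℕ}
    (ih : ∀ g : C(Sph (k + 1), Sph (k + 1)), ¬ g.Nullhomotopic → ∃ γ : C(Tor (k + 1), Sph (k + 1)), ∃ᶠ M in Filter.atTop, deg M (g.comp γ) ≠ 0)
    (f : C(Sph (k + 2), Sph (k + 2))) (hf : ¬ f.Nullhomotopic) :
    ∃ γ : C(Tor (k + 2), Sph (k + 2)), ∃ᶠ M in Filter.atTop, deg M (f.comp γ) ≠ 0 := by
  obtain ⟨O, g, hg, hh⟩ := desusp f hf
  obtain ⟨γ, hγ⟩ := ih g hg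
  refine ⟨O.comp (gam γ), ?_⟩
  have h1 := deg_inv _ _ (hh.comp (ContinuousMap.Homotopic.refl (gam γ)))
  refine (hγ.and_eventually (h1.and (Filter.eventually_ge_atTop 2))).mono ?_
  rintro M ⟨h2, h3, h4⟩
  rw [← ContinuousMap.comp_assoc, h3, deg_gam (by omega) γ g M h4]
  exact neg_ne_zero.2 h2

end step
end TCS

namespace TCS
section base

theorem windlift (φ : C(UnitAddCircle, Circle)) : ∃ (d : ℤ) (η : C(UnitAddCircle, ℝ)),
    ∀ s, φ s = Circle.exp (η s) * AddCircle.toCircle (d • s) := by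
  let Φ : C(ℝ, Circle) := ⟨fun t => φ (t : UnitAddCircle), φ.continuous.comp (AddCircle.continuous_mk' 1)⟩
  obtain ⟨θ, ⟨-, h2⟩, -⟩ := Circle.isCoveringMap_exp.existsUnique_continuousMap_lifts Φ 0
    (Complex.arg (Φ 0)) (Circle.exp_arg _)
  have h2' : ∀ t, Circle.exp (θ t) = φ (t : UnitAddCircle) := fun t => congrFun h2 t
  have hper : ∀ t : ℝ, φ ((t + 1 : ℝ) : UnitAddCircle) = φ (t : UnitAddCircle) := by
    intro t
    congr 1
    simp
  obtain ⟨d, hd⟩ : ∃ m : ℤ, θ 1 = θ 0 + m * (2 * Real.pi) := by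
    rw [← Circle.exp_eq_exp, h2', h2']
    simpa using hper 0
  let θ' : C(ℝ, ℝ) := ⟨fun t => θ (t + 1) - d * (2 * Real.pi), by fun_prop⟩
  have hθ' : θ' = θ := by
    refine (Circle.isCoveringMap_exp.existsUnique_continuousMap_lifts Φ 0 (θ 0) (h2' 0)).unique ⟨?_, ?_⟩ ⟨rfl, h2⟩
    · simp [θ', hd]
    · funext t
      have : Circle.exp (θ (t + 1) - d * (2 * Real.pi)) = Circle.exp (θ (t + 1)) := by
        rw [Circle.exp_eq_exp]
        exact ⟨-d, by push_cast; ring⟩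
      change Circle.exp (θ (t + 1) - d * (2 * Real.pi)) = φ (t : UnitAddCircle)
      rw [this, h2', hper]
  have hp : Function.Periodic (fun t => θ t - d * (2 * Real.pi) * t) 1 := by
    intro t
    have := DFunLike.congr_fun hθ' t
    simp only [θ', ContinuousMap.coe_mk] at this
    simp only
    linarith
  refine ⟨d, ⟨hp.lift, ?_⟩, ?_⟩
  · exact continuous_coinduced_dom.mpr (by fun_prop : Continuous (fun t => θ t - d * (2 * Real.pi) * t))
  · intro s
    induction s using QuotientAddGroup.induction_on with
    | H t =>
      have e1 : hp.lift (t : UnitAddCircle) = θ t - d * (2 * Real.pi) * t := hp.lift_coe t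
      have e2 : d • (t : UnitAddCircle) = ((d * t : ℝ) : UnitAddCircle) := by
        rw [← zsmul_eq_mul]; rfl
      change φ (t : UnitAddCircle) = Circle.exp (hp.lift (t : UnitAddCircle)) * AddCircle.toCircle (d • (t : UnitAddCircle))
      rw [e1, e2, AddCircle.toCircle_apply_mk, ← Circle.exp_add, ← h2']
      congr 1; ring

noncomputable def LC : ℂ ≃ₗᵢ[ℝ] Eu 2 := Complex.orthonormalBasisOneI.repr

theorem ofC_mem (w : Circle) : LC (w : ℂ) ∈ Metric.sphere (0 : Eu 2) 1 := by
  rw [mem_sphere_zero_iff_norm, LinearIsometryEquiv.norm_map, Circle.norm_coe]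

theorem toC_mem (x : Sph 1) : LC.symm (x : Eu 2) ∈ Submonoid.unitSphere ℂ := by
  change _ ∈ Metric.sphere (0 : ℂ) 1
  rw [mem_sphere_zero_iff_norm, LinearIsometryEquiv.norm_map, sph_norm]

noncomputable def ofC : C(Circle, Sph 1) where
  toFun w := ⟨LC (w : ℂ), ofC_mem w⟩
  continuous_toFun := Continuous.subtype_mk (LC.continuous.comp continuous_subtype_val) _

noncomputable def toC : C(Sph 1, Circle) where
  toFun x := ⟨LC.symm (x : Eu 2), toC_mem x⟩
  continuous_toFun := Continuous.subtype_mk (LC.symm.continuous.comp continuous_subtype_val) _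

theorem ofC_toC (x : Sph 1) : ofC (toC x) = x := by
  apply Subtype.ext
  exact LC.apply_symm_apply (x : Eu 2)

theorem ofC_zero (w : Circle) : (ofC w : Eu 2) 0 = (w : ℂ).re := by
  simp [ofC, LC, Complex.orthonormalBasisOneI]
theorem ofC_one (w : Circle) : (ofC w : Eu 2) 1 = (w : ℂ).im := by
  simp [ofC, LC, Complex.orthonormalBasisOneI]

noncomputable def wnd (D : ℕ) : C(Tor 1, Sph 1) :=
  ofC.comp ⟨fun z => AddCircle.toCircle (D • z 0), by
    exact AddCircle.continuous_toCircle.comp ((continuous_nsmul D).comp (continuous_apply 0))⟩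

theorem deg_wnd (D K M : ℕ) (hK : 3 ≤ K) (hM : M + 1 = D * K) : deg M (wnd D) = - D := by
  have hD : D ≠ 0 := by rintro rfl; simp at hM
  have key : ∀ j : ℕ, D • (ZMod.toAddCircle (j : ZMod (M + 1))) = ((j / K : ℝ) : UnitAddCircle) := by
    intro j
    rw [ZMod.toAddCircle_natCast, ← AddCircle.coe_nsmul]
    congr 1
    rw [hM]
    have : (K : ℝ) ≠ 0 := by positivity
    have : (D : ℝ) ≠ 0 := by positivity
    rw [nsmul_eq_mul]
    push_cast
    field_simp
  have u0 : ∀ (z : Fin 1 → ZMod (M + 1)) (j : ℕ), z 0 = j → uu (wnd D) 0 z = cf K j := by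
    intro z j hj
    have : uu (wnd D) 0 z = if 0 < (wnd D (grid z) : Eu 2) 0 then 1 else 0 := rfl
    rw [this, wnd, ContinuousMap.comp_apply, ofC_zero]
    change (if 0 < cc (D • (ZMod.toAddCircle (z 0))) then (1 : ℤ) else 0) = _
    rw [hj, key, cc_coe]; rfl
  have u1 : ∀ (z : Fin 1 → ZMod (M + 1)) (j : ℕ), z 0 = j → uu (wnd D) 1 z = sf K j := by
    intro z j hj
    have : uu (wnd D) 1 z = if 0 < (wnd D (grid z) : Eu 2) 1 then 1 else 0 := rfl
    rw [this, wnd, ContinuousMap.comp_apply, ofC_one]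
    change (if 0 < ss (D • (ZMod.toAddCircle (z 0))) then (1 : ℤ) else 0) = _
    rw [hj, key, ss_coe]; rfl
  unfold deg EE
  rw [← kap_mul K D hK, ← hM, ← sum_zmod (M + 1)]
  refine Fintype.sum_equiv (Equiv.funUnique (Fin 1) (ZMod (M + 1))) _ _ fun g => ?_
  rw [Fintype.sum_unique]
  have hs : (default : Equiv.Perm (Fin 1)) = 1 := rfl
  rw [hs]
  simp only [Equiv.Perm.sign_one, aa, bb, Finset.prod_range_one, Equiv.funUnique_apply]
  have hd : (default : Fin 1) = 0 := rfl
  have e : g 0 = ((g 0).val : ZMod (M + 1)) := by simp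
  have e0 : pth g (1 : Equiv.Perm (Fin 1)) 0 0 = ((g 0).val : ZMod (M + 1)) := by simp [pth]
  have e1 : pth g (1 : Equiv.Perm (Fin 1)) 1 0 = (((g 0).val + 1 : ℕ) : ZMod (M + 1)) := by simp [pth]
  rw [u0 _ _ e0, u0 _ _ e1, u1 _ _ e1, hd, hf]
  simp

theorem hopf_base (f : C(Sph 1, Sph 1)) (hf : ¬ f.Nullhomotopic) :
    ∃ γ : C(Tor 1, Sph 1), ∃ᶠ M in Filter.atTop, deg M (f.comp γ) ≠ 0 := by
  let tc : C(UnitAddCircle, Circle) := ⟨AddCircle.toCircle, AddCircle.continuous_toCircle⟩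
  let φ : C(UnitAddCircle, Circle) := toC.comp (f.comp (ofC.comp tc))
  obtain ⟨d, η, hη⟩ := windlift φ
  let ψ : C(UnitAddCircle, Circle) := ⟨fun s => AddCircle.toCircle (d • s),
    AddCircle.continuous_toCircle.comp (continuous_zsmul d)⟩
  have hH : φ.Homotopic ψ := by
    refine ⟨⟨⟨fun p => Circle.exp ((1 - (p.1 : ℝ)) * η p.2) * ψ p.2, ?_⟩, ?_, ?_⟩⟩
    · exact (Circle.exp.continuous.comp (by fun_prop)).mul (by fun_prop)
    · intro s; simp [hη, ψ]
    · intro s; simp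
  have hfφ : ∀ s, f (ofC (tc s)) = ofC (φ s) := by
    intro s; simp only [φ, ContinuousMap.comp_apply, ofC_toC]
  rcases eq_or_ne d 0 with rfl | hd
  · exfalso
    apply hf
    let hc : C(Circle, UnitAddCircle) := ⟨(AddCircle.homeomorphCircle (one_ne_zero : (1 : ℝ) ≠ 0)).symm,
      Homeomorph.continuous _⟩
    have e : f = (ofC.comp φ).comp (hc.comp toC) := by
      ext1 x
      simp only [ContinuousMap.comp_apply]
      rw [← hfφ]
      congr 1
      have : tc (hc (toC x)) = toC x := by
        have := (AddCircle.homeomorphCircle (one_ne_zero : (1 : ℝ) ≠ 0)).apply_symm_apply (toC x)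
        rw [AddCircle.homeomorphCircle_apply] at this
        exact this
      rw [this, ofC_toC]
    have h3 : ψ = ContinuousMap.const _ 1 := by
      ext1 s; simp [ψ]
    rw [h3] at hH
    refine ⟨ofC 1, ?_⟩
    rw [e]
    exact ((ContinuousMap.Homotopic.refl ofC).comp hH).comp (ContinuousMap.Homotopic.refl (hc.comp toC))
  · let r : C(Tor 1, UnitAddCircle) := ⟨fun z => d.sign • z 0, (continuous_zsmul _).comp (continuous_apply 0)⟩
    refine ⟨ofC.comp (tc.comp r), ?_⟩
    have e1 : f.comp (ofC.comp (tc.comp r)) = ofC.comp (φ.comp r) := by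
      ext1 z
      exact hfφ _
    have e2 : ofC.comp (ψ.comp r) = wnd d.natAbs := by
      ext1 z
      simp only [wnd, ContinuousMap.comp_apply, ψ, r, ContinuousMap.coe_mk]
      congr 2
      rw [smul_smul, Int.mul_sign_self, natCast_zsmul]
    have hh : (f.comp (ofC.comp (tc.comp r))).Homotopic (wnd d.natAbs) := by
      rw [e1, ← e2]
      exact (ContinuousMap.Homotopic.refl ofC).comp (hH.comp (ContinuousMap.Homotopic.refl r))
    have h5 : ∃ᶠ M in Filter.atTop, deg M (wnd d.natAbs) ≠ 0 := by
      rw [Filter.frequently_atTop]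
      intro a
      have h0 : 0 < d.natAbs := Int.natAbs_pos.2 hd
      have h1 : a + 3 ≤ d.natAbs * (a + 3) := Nat.le_mul_of_pos_left _ h0
      refine ⟨d.natAbs * (a + 3) - 1, by omega, ?_⟩
      rw [deg_wnd d.natAbs (a + 3) _ (by omega) (by omega)]
      simp [hd]
    refine (h5.and_eventually (deg_inv _ _ hh)).mono ?_
    rintro M ⟨h6, h7⟩
    rw [h7]; exact h6

theorem hopf (k : ℕ) : ∀ f : C(Sph (k + 1), Sph (k + 1)), ¬ f.Nullhomotopic →
    ∃ γ : C(Tor (k + 1), Sph (k + 1)), ∃ᶠ M in Filter.atTop, deg M (f.comp γ) ≠ 0 := by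
  induction k with
  | zero => exact hopf_base
  | succ k ih => exact hopf_step ih

end base
end TCS

namespace TCS
section tc

theorem slf {m : ℕ} (v : Eu m) (h : v = -v) : v = 0 := by
  ext i
  have := congrArg (fun w : Eu m => w i) h
  simp only [PiLp.neg_apply] at this
  simp only [PiLp.zero_apply]
  linarith

theorem fcat_iff {X Y : Type} [TopologicalSpace X] [TopologicalSpace Y] (f : C(X, Y)) (U : Set (X × X)) :
    IsFCatOpen (pathFib X) (f.prodMap f) U ↔ IsOpen U ∧
      (f.comp (ContinuousMap.fst.restrict U)).Homotopic (f.comp (ContinuousMap.snd.restrict U)) := by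
  constructor
  · rintro ⟨ho, s, hs⟩
    refine ⟨ho, ?_⟩
    have h1 := (ContinuousMap.Homotopic.refl (ContinuousMap.fst : C(Y × Y, Y))).comp hs
    have h2 := (ContinuousMap.Homotopic.refl (ContinuousMap.snd : C(Y × Y, Y))).comp hs
    let s0 : C(U, X) := ⟨fun u => s u 0, by fun_prop⟩
    let s1 : C(U, X) := ⟨fun u => s u 1, by fun_prop⟩
    have h3 : s0.Homotopic s1 :=
      ⟨⟨⟨fun p => s p.2 p.1, by fun_prop⟩, fun u => rfl, fun u => rfl⟩⟩
    have h4 : (f.comp s0).Homotopic (f.comp s1) := (ContinuousMap.Homotopic.refl f).comp h3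
    exact (h1.symm.trans h4).trans h2
  · rintro ⟨ho, ⟨H⟩⟩
    refine ⟨ho, ⟨fun u => ContinuousMap.const _ u.1.1, ContinuousMap.continuous_const'.comp (by fun_prop)⟩, ?_⟩
    refine ⟨⟨⟨fun p => (f p.2.1.1, H p), by fun_prop⟩, fun u => ?_, fun u => ?_⟩⟩
    · change (f u.1.1, H (0, u)) = (f u.1.1, f u.1.1)
      rw [H.apply_zero]; rfl
    · change (f u.1.1, H (1, u)) = (f u.1.1, f u.1.2)
      rw [H.apply_one]; rfl

theorem low_univ {n : ℕ} (f : C(Sph n, Sph n)) (hf : ¬ f.Nullhomotopic) (U : Set (Sph n × Sph n))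
    (hU : U = univ) (h : (f.comp (ContinuousMap.fst.restrict U)).Homotopic (f.comp (ContinuousMap.snd.restrict U))) :
    False := by
  subst hU
  apply hf
  let j : C(Sph n, (univ : Set (Sph n × Sph n))) := ⟨fun x => ⟨(x, ptS n), mem_univ _⟩, by fun_prop⟩
  exact ⟨f (ptS n), h.comp (ContinuousMap.Homotopic.refl j)⟩

theorem low_two {q : ℕ} (hq : Even (q + 1)) (f : C(Sph (q + 1), Sph (q + 1))) (hf : ¬ f.Nullhomotopic)
    (U V : Set (Sph (q + 1) × Sph (q + 1))) (hUV : U ∪ V = univ) (hoU : IsOpen U) (hoV : IsOpen V)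
    (hU : (f.comp (ContinuousMap.fst.restrict U)).Homotopic (f.comp (ContinuousMap.snd.restrict U)))
    (hV : (f.comp (ContinuousMap.fst.restrict V)).Homotopic (f.comp (ContinuousMap.snd.restrict V))) :
    False := by
  obtain ⟨γ, hγ⟩ := hopf q f hf
  let Q : C(Tor ((q + 1) + (q + 1)), Sph (q + 1) × Sph (q + 1)) := (γ.comp (pL (q + 1))).prodMk (γ.comp (pR (q + 1)))
  have pull : ∀ W : Set (Sph (q + 1) × Sph (q + 1)),
      (f.comp (ContinuousMap.fst.restrict W)).Homotopic (f.comp (ContinuousMap.snd.restrict W)) →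
      (((f.comp γ).comp (pL (q + 1))).restrict (Q ⁻¹' W)).Homotopic
        (((f.comp γ).comp (pR (q + 1))).restrict (Q ⁻¹' W)) := by
    intro W hW
    let j : C(Q ⁻¹' W, W) := ⟨fun z => ⟨Q z.1, z.2⟩, by fun_prop⟩
    exact hW.comp (ContinuousMap.Homotopic.refl j)
  have := partB hq (f.comp γ) (Q ⁻¹' U) (Q ⁻¹' V) (hoU.preimage Q.continuous) (hoV.preimage Q.continuous)
    (by rw [← preimage_union, hUV, preimage_univ]) (pull U hU) (pull V hV)
  exact hγ (this.mono fun M h => by simpa using h)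

def tau (m : ℕ) (i : Fin (2 * m)) : Fin (2 * m) :=
  if h : i.val % 2 = 0 then ⟨i.val + 1, by omega⟩ else ⟨i.val - 1, by omega⟩

theorem tau_val (m : ℕ) (i : Fin (2 * m)) : (tau m i).val = if i.val % 2 = 0 then i.val + 1 else i.val - 1 := by
  unfold tau; split_ifs <;> rfl

theorem tau_inv (m : ℕ) : Function.Involutive (tau m) := by
  intro i
  apply Fin.ext
  rw [tau_val, tau_val]
  split_ifs <;> omega

noncomputable def JJ (m : ℕ) (x : Eu (2 * m)) : Eu (2 * m) :=
  WithLp.toLp 2 (fun i => (if i.val % 2 = 0 then -1 else 1) * x (tau m i))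

theorem JJ_cont (m : ℕ) : Continuous (JJ m) := by
  unfold JJ; fun_prop

theorem JJ_norm (m : ℕ) (x : Eu (2 * m)) : ‖JJ m x‖ = ‖x‖ := by
  rw [← sq_eq_sq₀ (norm_nonneg _) (norm_nonneg _), EuclideanSpace.norm_sq_eq, EuclideanSpace.norm_sq_eq,
    ← Equiv.sum_comp (tau_inv m).toPerm (fun i => ‖x i‖ ^ 2)]
  refine Finset.sum_congr rfl fun i _ => ?_
  simp only [JJ, Function.Involutive.coe_toPerm]
  split_ifs <;> simp

theorem JJ_JJ (m : ℕ) (x : Eu (2 * m)) : JJ m (JJ m x) = -x := by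
  ext i
  simp only [JJ, PiLp.neg_apply, tau_inv m i, tau_val]
  by_cases h : i.val % 2 = 0
  · rw [if_pos h, if_pos h, if_neg (by omega)]; ring
  · rw [if_neg h, if_neg h, if_pos (by omega)]; ring

theorem exJ {n : ℕ} (hn : Odd n) : ∃ J : C(Sph n, Sph n), ∀ x,
    (J x : Eu (n + 1)) ≠ x ∧ (J x : Eu (n + 1)) ≠ - x := by
  obtain ⟨j, rfl⟩ := hn
  have hj : 2 * j + 1 + 1 = 2 * (j + 1) := by ring
  have hmem : ∀ x : Sph (2 * j + 1), JJ (j + 1) (x : Eu (2 * j + 1 + 1)) ∈ Metric.sphere (0 : Eu (2 * j + 1 + 1)) 1 := by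
    intro x
    rw [mem_sphere_zero_iff_norm]
    exact (JJ_norm (j + 1) x).trans (sph_norm x)
  let J : C(Sph (2 * j + 1), Sph (2 * j + 1)) := 
    ⟨fun x => ⟨JJ (j + 1) (x : Eu (2 * j + 1 + 1)), hmem x⟩, Continuous.subtype_mk ((JJ_cont (j + 1)).comp continuous_subtype_val) _⟩
  have hJ : ∀ x, (J (J x) : Eu (2 * j + 1 + 1)) = - x := fun x => JJ_JJ (j + 1) x
  refine ⟨J, fun x => ⟨fun h => ?_, fun h => ?_⟩⟩
  · have h1 : J x = x := Subtype.ext h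
    have h2 := hJ x
    rw [h1, h1] at h2
    exact sph_ne x (slf _ h2)
  · have h1 : J x = -x := Subtype.ext h
    have h2 := hJ x
    have h3 : (J (-x) : Eu (2 * j + 1 + 1)) = x := by
      have : (J (-x) : Eu (2 * j + 1 + 1)) = - (J x : Eu (2 * j + 1 + 1)) := by
        change JJ (j + 1) (-(x : Eu (2 * j + 1 + 1))) = - JJ (j + 1) (x : Eu (2 * j + 1 + 1))
        ext i
        simp [JJ]
      rw [this, h]; simp
    rw [h1, h3] at h2
    exact sph_ne x (slf _ h2)

variable {n : ℕ}

theorem up1 (U : Set (Sph n × Sph n)) (h : ∀ p ∈ U, (p.1 : Eu (n + 1)) ≠ - (p.2 : Eu (n + 1))) :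
    ((ContinuousMap.fst.restrict U : C(U, Sph n))).Homotopic (ContinuousMap.snd.restrict U) :=
  hom_antip _ _ fun u => h u.1 u.2

noncomputable def ngS (n : ℕ) : C(Sph n, Sph n) := ⟨fun x => -x, continuous_neg⟩

theorem up2 (U : Set (Sph n × Sph n)) (h : ∀ p ∈ U, (p.1 : Eu (n + 1)) ≠ (p.2 : Eu (n + 1))) :
    ((ContinuousMap.fst.restrict U : C(U, Sph n))).Homotopic ((ngS n).comp (ContinuousMap.snd.restrict U)) :=
  hom_antip _ _ fun u => by
    change (u.1.1 : Eu (n + 1)) ≠ - -(u.1.2 : Eu (n + 1))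
    rw [neg_neg]
    exact h u.1 u.2

theorem up_odd (hn : Odd n) (U : Set (Sph n × Sph n)) (h : ∀ p ∈ U, (p.1 : Eu (n + 1)) ≠ (p.2 : Eu (n + 1))) :
    ((ContinuousMap.fst.restrict U : C(U, Sph n))).Homotopic (ContinuousMap.snd.restrict U) := by
  obtain ⟨J, hJ⟩ := exJ hn
  have h1 : (ngS n).Homotopic J := hom_antip _ _ fun x => by
    change -(x : Eu (n + 1)) ≠ - _
    intro h
    exact (hJ x).1 (neg_injective h).symm
  have h2 : J.Homotopic (ContinuousMap.id _) := hom_antip _ _ fun x => (hJ x).2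
  exact (up2 U h).trans ((h1.trans h2).comp (ContinuousMap.Homotopic.refl (ContinuousMap.snd.restrict U)))

theorem up_even (e e' : Sph n) (h1 : (e : Eu (n + 1)) ≠ e') (h2 : (e : Eu (n + 1)) ≠ - (e' : Eu (n + 1)))
    (U : Set (Sph n × Sph n)) (h : ∀ p ∈ U, (p.1 : Eu (n + 1)) ≠ (p.2 : Eu (n + 1)))
    (h' : ∀ p ∈ U, (p.2 : Eu (n + 1)) ≠ (e : Eu (n + 1))) :
    ((ContinuousMap.fst.restrict U : C(U, Sph n))).Homotopic (ContinuousMap.snd.restrict U) := by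
  have a1 : ((ngS n).comp (ContinuousMap.snd.restrict U)).Homotopic (ContinuousMap.const _ e) :=
    hom_antip _ _ fun u => by
      change -(u.1.2 : Eu (n + 1)) ≠ -(e : Eu (n + 1))
      exact fun h => h' u.1 u.2 (neg_injective h)
  have a2 : (ContinuousMap.const U e).Homotopic (ContinuousMap.const U e') := hom_antip _ _ fun _ => h2
  have a3 : (ContinuousMap.const U e').Homotopic (ContinuousMap.const U (-e)) := hom_antip _ _ fun _ => by
    change (e' : Eu (n + 1)) ≠ - -(e : Eu (n + 1))
    rw [neg_neg]; exact h1.symm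
  have a4 : (ContinuousMap.const U (-e)).Homotopic (ContinuousMap.snd.restrict U) := hom_antip _ _ fun u => by
    change -(e : Eu (n + 1)) ≠ -(u.1.2 : Eu (n + 1))
    exact fun h => h' u.1 u.2 (neg_injective h).symm
  exact (up2 U h).trans (a1.trans (a2.trans (a3.trans a4)))

theorem TC_eq (hn : 1 ≤ n) (f : C(Sph n, Sph n)) (hf : ¬ f.Nullhomotopic) :
    TCmap f = if Odd n then 1 else 2 := by
  have hcomp : ∀ U : Set (Sph n × Sph n), IsOpen U →
      ((ContinuousMap.fst.restrict U : C(U, Sph n))).Homotopic (ContinuousMap.snd.restrict U) →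
      IsFCatOpen (pathFib (Sph n)) (f.prodMap f) U := fun U ho h =>
    (fcat_iff f U).2 ⟨ho, (ContinuousMap.Homotopic.refl f).comp h⟩
  have c1 : Continuous (fun p : Sph n × Sph n => (p.1 : Eu (n + 1))) := by fun_prop
  have c2 : Continuous (fun p : Sph n × Sph n => (p.2 : Eu (n + 1))) := by fun_prop
  let A : Set (Sph n × Sph n) := {p | (p.1 : Eu (n + 1)) ≠ - (p.2 : Eu (n + 1))}
  let B : Set (Sph n × Sph n) := {p | (p.1 : Eu (n + 1)) ≠ (p.2 : Eu (n + 1))}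
  have hA : IsOpen A := isOpen_ne_fun c1 c2.neg
  have hB : IsOpen B := isOpen_ne_fun c1 c2
  have hAB : ∀ p, p ∉ A → p ∈ B := by
    intro p hp
    simp only [A, mem_setOf_eq, not_not] at hp
    simp only [B, mem_setOf_eq, hp]
    intro h
    exact sph_ne p.2 (slf _ h.symm)
  split_ifs with hodd
  · apply le_antisymm
    · apply sInf_le
      refine ⟨1, ⟨![A, B], ?_, ?_⟩, by simp⟩
      · intro i
        fin_cases i
        · exact hcomp A hA (up1 A fun p hp => hp)
        · exact hcomp B hB (up_odd hodd B fun p hp => hp)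
      · rw [eq_univ_iff_forall]
        intro p
        rw [mem_iUnion]
        by_cases hp : p ∈ A
        · exact ⟨0, hp⟩
        · exact ⟨1, hAB p hp⟩
    · apply le_sInf
      rintro _ ⟨k, ⟨U, hU, hc⟩, rfl⟩
      have : k ≠ 0 := by
        rintro rfl
        refine low_univ f hf (U 0) ?_ ((fcat_iff f _).1 (hU 0)).2
        rw [← hc]
        ext p; simp [mem_iUnion, Fin.exists_fin_one]
      exact_mod_cast Nat.one_le_iff_ne_zero.2 this
  · have heven : Even n := Nat.not_odd_iff_even.1 hodd
    obtain ⟨q, rfl⟩ : ∃ q, n = q + 1 := ⟨n - 1, by omega⟩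
    let e : Sph (q + 1) := ⟨EuclideanSpace.single 0 1, by simp⟩
    let e' : Sph (q + 1) := ⟨EuclideanSpace.single 1 1, by simp⟩
    have hee : (e : Eu (q + 2)) 0 = 1 := by simp [e]
    have hee' : (e' : Eu (q + 2)) 0 = 0 := by simp [e']
    have hne : (-e : Sph (q + 1)) = (-(e : Eu (q + 2)) : Eu (q + 2)) := rfl
    let B1 := B ∩ {p | (p.2 : Eu (q + 2)) ≠ e}
    let B2 := B ∩ {p | (p.2 : Eu (q + 2)) ≠ (-e : Sph (q + 1))}
    have hB1 : IsOpen B1 := hB.inter (isOpen_ne_fun c2 continuous_const)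
    have hB2 : IsOpen B2 := hB.inter (isOpen_ne_fun c2 continuous_const)
    apply le_antisymm
    · apply sInf_le
      refine ⟨2, ⟨![A, B1, B2], ?_, ?_⟩, by simp⟩
      · intro i
        fin_cases i
        · exact hcomp A hA (up1 A fun p hp => hp)
        · refine hcomp B1 hB1 (up_even e e' ?_ ?_ B1 (fun p hp => hp.1) (fun p hp => hp.2))
          · intro h
            have := congrArg (fun v : Eu (q + 2) => v 0) h
            simp [hee, hee'] at this
          · intro h
            have := congrArg (fun v : Eu (q + 2) => v 0) h
            simp [hee, hee'] at this
        · refine hcomp B2 hB2 (up_even (-e) e' ?_ ?_ B2 (fun p hp => hp.1) (fun p hp => hp.2))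
          · intro h
            have := congrArg (fun v : Eu (q + 2) => v 0) h
            simp [hee, hee', hne] at this
          · intro h
            have := congrArg (fun v : Eu (q + 2) => v 0) h
            simp [hee, hee', hne] at this
      · rw [eq_univ_iff_forall]
        intro p
        rw [mem_iUnion]
        by_cases hp : p ∈ A
        · exact ⟨0, hp⟩
        · by_cases hp2 : (p.2 : Eu (q + 2)) = e
          · refine ⟨2, hAB p hp, ?_⟩
            change (p.2 : Eu (q + 2)) ≠ -(e : Eu (q + 2))
            rw [hp2]
            intro h
            exact sph_ne e (slf _ h)
          · exact ⟨1, hAB p hp, hp2⟩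
    · apply le_sInf
      rintro _ ⟨k, ⟨U, hU, hc⟩, rfl⟩
      have h2 : 2 ≤ k := by
        by_contra hk
        have hk' : k = 0 ∨ k = 1 := by omega
        rcases hk' with rfl | rfl
        · have h0 := (fcat_iff f _).1 (hU 0)
          refine low_two heven f hf (U 0) (U 0) ?_ h0.1 h0.1 h0.2 h0.2
          rw [← hc]
          ext p; simp [mem_iUnion, Fin.exists_fin_one]
        · have h0 := (fcat_iff f _).1 (hU 0)
          have h1 := (fcat_iff f _).1 (hU 1)
          refine low_two heven f hf (U 0) (U 1) ?_ h0.1 h1.1 h0.2 h1.2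
          rw [← hc]
          ext p; simp [mem_iUnion, Fin.exists_fin_two]
      exact_mod_cast h2

end tc
end TCS

theorem TCmap_sphere_selfmap (n : ℕ) (hn : 1 ≤ n)
    (f : C((Metric.sphere (0 : EuclideanSpace ℝ (Fin (n + 1))) 1),
          (Metric.sphere (0 : EuclideanSpace ℝ (Fin (n + 1))) 1)))
    (hf : ¬ f.Nullhomotopic) :
    TCmap f = TCmap (ContinuousMap.id (Metric.sphere (0 : EuclideanSpace ℝ (Fin (n + 1))) 1)) ∧
      TCmap (ContinuousMap.id (Metric.sphere (0 : EuclideanSpace ℝ (Fin (n + 1))) 1)) =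
        if Odd n then 1 else 2 := by
  have hid : ¬ (ContinuousMap.id (Metric.sphere (0 : EuclideanSpace ℝ (Fin (n + 1))) 1)).Nullhomotopic := by
    rintro ⟨y, hy⟩
    exact hf ⟨f y, (ContinuousMap.Homotopic.refl f).comp hy⟩
  have h1 := TCS.TC_eq hn f hf
  have h2 := TCS.TC_eq hn _ hid
  exact ⟨h1.trans h2.symm, h2⟩
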